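/- arXiv:2010.07902 — 3 statements merged into one kernel-verified Lean document; each statement's English description precedes it below -/
import Mathlib

section
/- Let ρ be a quantum state on a composite system F ⊗ X_1 ⊗ … ⊗ X_n of finite-dimensional systems, and let μ be an integer with 1 ≤ μ and 2μ ≤ n. Then E_{|J|=μ} S(F|X_J)_ρ ≥ 0, where the expectation is the uniform average over all μ-element subsets J ⊆ {1,…,n}. -/
open scoped BigOperators ComplexOrder

/-- Von Neumann entropy of a matrix: `-∑ λ_j log λ_j` over the eigenvalues,
if the matrix is Hermitian (else junk value 0). Natural logarithm,
with the convention `0 * log 0 = 0` (automatic since `Real.log 0 = 0`). -/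
noncomputable def vnEntropy {m : Type*} [Fintype m] [DecidableEq m]
    (ρ : Matrix m m ℂ) : ℝ :=
  if h : ρ.IsHermitian then
    -∑ j, h.eigenvalues j * Real.log (h.eigenvalues j)
  else 0

/-- Marginal (partial trace) of a state on the composite system
`⨂_{i : ι} X_i` (with `X_i = ℂ^{dim i}`), keeping the factors in `S`. -/
noncomputable def marginal {ι : Type*} [Fintype ι] [DecidableEq ι]
    {dim : ι → ℕ}
    (ρ : Matrix ((i : ι) → Fin (dim i)) ((i : ι) → Fin (dim i)) ℂ)
    (S : Finset ι) :
    Matrix ((i : {j : ι // j ∈ S}) → Fin (dim i.1))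
           ((i : {j : ι // j ∈ S}) → Fin (dim i.1)) ℂ :=
  fun x y =>
    ∑ z : (i : {j : ι // j ∉ S}) → Fin (dim i.1),
      ρ (fun i => if h : i ∈ S then x ⟨i, h⟩ else z ⟨i, h⟩)
        (fun i => if h : i ∈ S then y ⟨i, h⟩ else z ⟨i, h⟩)

/-- Entropy of the marginal of `ρ` on the factors in `S`. -/
noncomputable def mEnt {ι : Type*} [Fintype ι] [DecidableEq ι]
    {dim : ι → ℕ}
    (ρ : Matrix ((i : ι) → Fin (dim i)) ((i : ι) → Fin (dim i)) ℂ)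
    (S : Finset ι) : ℝ :=
  vnEntropy (marginal ρ S)



namespace SSA

open Matrix

/-- linear functional -/
noncomputable def qL {m : Type*} [Fintype m] (s : ℝ) (ρ σ Y : Matrix m m ℂ) : ℝ :=
  (2 * (ρ * Y).trace - (σ * (Yᴴ * Y)).trace - s * (ρ * (Y * Yᴴ)).trace).re

/-- partial trace over second factor -/
noncomputable def ptr {X C : Type*} [Fintype C] (ρ : Matrix (X × C) (X × C) ℂ) : Matrix X X ℂ :=
  fun x y => ∑ c, ρ (x, c) (y, c)

lemma trace_ptr {X C : Type*} [Fintype X] [Fintype C] [DecidableEq C]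
    (ρ : Matrix (X × C) (X × C) ℂ) (Y : Matrix X X ℂ) :
    (ρ * Matrix.kronecker Y (1 : Matrix C C ℂ)).trace = (ptr ρ * Y).trace := by
  simp only [Matrix.trace, Matrix.diag, Matrix.mul_apply, ptr, Fintype.sum_prod_type,
    Matrix.kronecker, Matrix.kroneckerMap_apply, Matrix.one_apply, Finset.sum_mul]
  refine Finset.sum_congr rfl fun x _ => ?_
  rw [Finset.sum_comm]
  refine Finset.sum_congr rfl fun y _ => Finset.sum_congr rfl fun c _ => ?_
  simp

lemma qL_ptr {X C : Type*} [Fintype X] [Fintype C] [DecidableEq C] [DecidableEq X]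
    (s : ℝ) (ρ σ : Matrix (X × C) (X × C) ℂ) (Y : Matrix X X ℂ) :
    qL s ρ σ (Matrix.kronecker Y (1 : Matrix C C ℂ)) = qL s (ptr ρ) (ptr σ) Y := by
  have h1 : (Matrix.kronecker Y (1 : Matrix C C ℂ))ᴴ = Matrix.kronecker Yᴴ 1 := by
    exact (Matrix.conjTranspose_kronecker Y (1 : Matrix C C ℂ)).trans (by rw [Matrix.conjTranspose_one]; rfl)
  have h2 : ∀ A B : Matrix X X ℂ, Matrix.kronecker A (1 : Matrix C C ℂ) * Matrix.kronecker B 1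
      = Matrix.kronecker (A * B) 1 := by
    intro A B
    have := (Matrix.mul_kronecker_mul A B (1 : Matrix C C ℂ) (1 : Matrix C C ℂ)).symm
    rw [Matrix.one_mul] at this
    exact this
  simp only [qL, h1, h2, trace_ptr]

/-- spectral data -/
def Spec {m : Type*} [Fintype m] [DecidableEq m] (ρ U : Matrix m m ℂ) (p : m → ℝ) : Prop :=
  Uᴴ * U = 1 ∧ U * Uᴴ = 1 ∧ ρ = U * Matrix.diagonal (fun i => (p i : ℂ)) * Uᴴ

lemma qL_spec {m : Type*} [Fintype m] [DecidableEq m] {ρ σ U V : Matrix m m ℂ} {p q : m → ℝ}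
    (hρ : Spec ρ U p) (hσ : Spec σ V q) (s : ℝ) (Z : Matrix m m ℂ) :
    qL s ρ σ (U * Z * Vᴴ) = ∑ i, ∑ j, (2 * p i * (Z i j * (Vᴴ * U) j i).re
      - (q j + s * p i) * Complex.normSq (Z i j)) := by
  obtain ⟨hU, hU', rfl⟩ := hρ
  obtain ⟨hV, hV', rfl⟩ := hσ
  have e1 : (U * Matrix.diagonal (fun i => (p i : ℂ)) * Uᴴ * (U * Z * Vᴴ)).trace
      = ∑ i, ∑ j, (p i : ℂ) * (Z i j * (Vᴴ * U) j i) := by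
    have : U * Matrix.diagonal (fun i => (p i : ℂ)) * Uᴴ * (U * Z * Vᴴ)
        = U * (Matrix.diagonal (fun i => (p i : ℂ)) * ((Uᴴ * U) * Z * Vᴴ)) := by
      simp only [Matrix.mul_assoc]
    rw [this, hU, Matrix.one_mul, Matrix.trace_mul_comm, Matrix.mul_assoc, Matrix.mul_assoc]
    simp only [Matrix.trace, Matrix.diag, Matrix.diagonal_mul]
    refine Finset.sum_congr rfl fun i _ => ?_
    rw [Matrix.mul_apply (M := Z), Finset.mul_sum]
  have e2 : (V * Matrix.diagonal (fun i => (q i : ℂ)) * Vᴴ * ((U * Z * Vᴴ)ᴴ * (U * Z * Vᴴ))).trace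
      = ∑ i, ∑ j, (q j : ℂ) * Complex.normSq (Z i j) := by
    have : V * Matrix.diagonal (fun i => (q i : ℂ)) * Vᴴ * ((U * Z * Vᴴ)ᴴ * (U * Z * Vᴴ))
        = V * (Matrix.diagonal (fun i => (q i : ℂ)) * ((Vᴴ * V) * Zᴴ * (Uᴴ * U) * Z * Vᴴ)) := by
      simp only [Matrix.mul_assoc, Matrix.conjTranspose_mul, Matrix.conjTranspose_conjTranspose]
    rw [this, hU, hV, Matrix.one_mul, Matrix.mul_one, Matrix.trace_mul_comm, Matrix.mul_assoc,
      Matrix.mul_assoc, hV, Matrix.mul_one, Finset.sum_comm]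
    simp only [Matrix.trace, Matrix.diag, Matrix.diagonal_mul]
    refine Finset.sum_congr rfl fun i _ => ?_
    rw [Matrix.mul_apply, Finset.mul_sum]
    refine Finset.sum_congr rfl fun j _ => ?_
    rw [Matrix.conjTranspose_apply, Complex.normSq_eq_conj_mul_self]; rfl
  have e3 : (U * Matrix.diagonal (fun i => (p i : ℂ)) * Uᴴ * ((U * Z * Vᴴ) * (U * Z * Vᴴ)ᴴ)).trace
      = ∑ i, ∑ j, (p i : ℂ) * Complex.normSq (Z i j) := by
    have : U * Matrix.diagonal (fun i => (p i : ℂ)) * Uᴴ * ((U * Z * Vᴴ) * (U * Z * Vᴴ)ᴴ)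
        = U * (Matrix.diagonal (fun i => (p i : ℂ)) * ((Uᴴ * U) * Z * (Vᴴ * V) * Zᴴ * Uᴴ)) := by
      simp only [Matrix.mul_assoc, Matrix.conjTranspose_mul, Matrix.conjTranspose_conjTranspose]
    rw [this, hU, hV, Matrix.one_mul, Matrix.mul_one, Matrix.trace_mul_comm, Matrix.mul_assoc,
      Matrix.mul_assoc, hU, Matrix.mul_one]
    simp only [Matrix.trace, Matrix.diag, Matrix.diagonal_mul]
    refine Finset.sum_congr rfl fun i _ => ?_
    rw [Matrix.mul_apply, Finset.mul_sum]
    refine Finset.sum_congr rfl fun j _ => ?_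
    rw [Matrix.conjTranspose_apply, ← Complex.mul_conj]; rfl
  rw [qL, e1, e2, e3]
  simp only [Finset.mul_sum, ← Finset.sum_sub_distrib, Complex.re_sum]
  refine Finset.sum_congr rfl fun i _ => Finset.sum_congr rfl fun j _ => ?_
  simp [Complex.mul_re]
  ring

/-- resolvent quantity -/
noncomputable def Phi {m : Type*} [Fintype m] (U V : Matrix m m ℂ) (p q : m → ℝ) (s : ℝ) : ℝ :=
  ∑ i, ∑ j, Complex.normSq ((Vᴴ * U) j i) * (p i ^ 2 / (q j + s * p i))

lemma qL_le_Phi {m : Type*} [Fintype m] [DecidableEq m] {ρ σ U V : Matrix m m ℂ} {p q : m → ℝ}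
    (hρ : Spec ρ U p) (hσ : Spec σ V q) (hp : ∀ i, 0 ≤ p i) (hq : ∀ i, 0 < q i) {s : ℝ}
    (hs : 0 ≤ s) (Y : Matrix m m ℂ) : qL s ρ σ Y ≤ Phi U V p q s := by
  have hY : Y = U * (Uᴴ * Y * V) * Vᴴ := by
    have : U * (Uᴴ * Y * V) * Vᴴ = (U * Uᴴ) * Y * (V * Vᴴ) := by simp only [Matrix.mul_assoc]
    rw [this, hρ.2.1, hσ.2.1]; simp
  rw [hY, qL_spec hρ hσ, Phi]
  refine Finset.sum_le_sum fun i _ => Finset.sum_le_sum fun j _ => ?_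
  generalize (Uᴴ * Y * V) i j = z
  generalize (Vᴴ * U) j i = c
  have hd : 0 < q j + s * p i := by have := hq j; have := mul_nonneg hs (hp i); linarith
  generalize q j + s * p i = d at hd
  rw [← mul_div_assoc, le_div_iff₀ hd]
  simp only [Complex.normSq_apply, Complex.mul_re]
  nlinarith [sq_nonneg (d * z.re - p i * c.re), sq_nonneg (d * z.im + p i * c.im)]

lemma Phi_attained {m : Type*} [Fintype m] [DecidableEq m] {ρ σ U V : Matrix m m ℂ} {p q : m → ℝ}
    (hρ : Spec ρ U p) (hσ : Spec σ V q) (hp : ∀ i, 0 ≤ p i) (hq : ∀ i, 0 < q i) {s : ℝ}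
    (hs : 0 ≤ s) : ∃ Y : Matrix m m ℂ, qL s ρ σ Y = Phi U V p q s := by
  refine ⟨U * (Matrix.of fun i j => ((p i / (q j + s * p i) : ℝ) : ℂ) * star ((Vᴴ * U) j i)) * Vᴴ, ?_⟩
  rw [qL_spec hρ hσ, Phi]
  refine Finset.sum_congr rfl fun i _ => Finset.sum_congr rfl fun j _ => ?_
  rw [Matrix.of_apply]
  generalize (Vᴴ * U) j i = c
  have hd : 0 < q j + s * p i := by have := hq j; have := mul_nonneg hs (hp i); linarith
  generalize q j + s * p i = d at hd
  rw [Complex.normSq_mul, Complex.normSq_ofReal, mul_assoc ((p i / d : ℝ) : ℂ), Complex.re_ofReal_mul]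
  have h1 : (star c * c).re = Complex.normSq c := by
    simp [Complex.normSq_apply]
  have h2 : Complex.normSq (star c) = Complex.normSq c := Complex.normSq_conj c
  rw [h1, h2]
  field_simp
  ring

lemma Phi_mono {X C : Type*} [Fintype X] [Fintype C] [DecidableEq C] [DecidableEq X]
    {ρ σ U V : Matrix (X × C) (X × C) ℂ} {p q : X × C → ℝ} {U' V' : Matrix X X ℂ} {p' q' : X → ℝ}
    (hρ : Spec ρ U p) (hσ : Spec σ V q) (hp : ∀ i, 0 ≤ p i) (hq : ∀ i, 0 < q i)
    (hρ' : Spec (ptr ρ) U' p') (hσ' : Spec (ptr σ) V' q') (hp' : ∀ i, 0 ≤ p' i)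
    (hq' : ∀ i, 0 < q' i) {s : ℝ}
    (hs : 0 ≤ s) : Phi U' V' p' q' s ≤ Phi U V p q s := by
  obtain ⟨Y, hY⟩ := Phi_attained hρ' hσ' hp' hq' hs
  rw [← hY, ← qL_ptr]
  exact qL_le_Phi hρ hσ hp hq hs _

/-- integrated -/
noncomputable def Psi {m : Type*} [Fintype m] (U V : Matrix m m ℂ) (p q : m → ℝ) (s : ℝ) : ℝ :=
  ∑ i, ∑ j, Complex.normSq ((Vᴴ * U) j i) * (p i * Real.log (q j + s * p i))

lemma Psi_deriv {m : Type*} [Fintype m] (U V : Matrix m m ℂ) {p q : m → ℝ}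
    (hp : ∀ i, 0 ≤ p i) (hq : ∀ i, 0 < q i) {s : ℝ} (hs : 0 ≤ s) :
    HasDerivAt (Psi U V p q) (Phi U V p q s) s := by
  unfold Psi Phi
  refine HasDerivAt.fun_sum fun i _ => HasDerivAt.fun_sum fun j _ => ?_
  refine HasDerivAt.const_mul _ ?_
  have hd : 0 < q j + s * p i := by have := hq j; have := mul_nonneg hs (hp i); linarith
  have h := (((hasDerivAt_id s).mul_const (p i)).const_add (q j)).log hd.ne'
  have := h.const_mul (p i)
  simp only [id] at this
  convert this using 1
  ring

lemma Psi_mono {X C : Type*} [Fintype X] [Fintype C] [DecidableEq C] [DecidableEq X]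
    {ρ σ U V : Matrix (X × C) (X × C) ℂ} {p q : X × C → ℝ} {U' V' : Matrix X X ℂ} {p' q' : X → ℝ}
    (hρ : Spec ρ U p) (hσ : Spec σ V q) (hp : ∀ i, 0 ≤ p i) (hq : ∀ i, 0 < q i)
    (hρ' : Spec (ptr ρ) U' p') (hσ' : Spec (ptr σ) V' q') (hp' : ∀ i, 0 ≤ p' i)
    (hq' : ∀ i, 0 < q' i) {s : ℝ}
    (hs : 0 ≤ s) : Psi U' V' p' q' s - Psi U' V' p' q' 0 ≤ Psi U V p q s - Psi U V p q 0 := by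
  have hd : ∀ t : ℝ, 0 ≤ t → HasDerivAt (fun t => Psi U V p q t - Psi U' V' p' q' t)
      (Phi U V p q t - Phi U' V' p' q' t) t := fun t ht =>
    (Psi_deriv U V hp hq ht).sub (Psi_deriv U' V' hp' hq' ht)
  have := monotoneOn_of_deriv_nonneg (convex_Ici (0 : ℝ))
    (fun t ht => (hd t ht).continuousAt.continuousWithinAt)
    (fun t ht => (hd t (interior_subset ht)).differentiableAt.differentiableWithinAt)
    (fun t ht => by
      rw [(hd t (interior_subset ht)).deriv]
      exact sub_nonneg.2 (Phi_mono hρ hσ hp hq hρ' hσ' hp' hq' (interior_subset ht)))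
  have := this (Set.self_mem_Ici) (Set.mem_Ici.2 hs) hs
  simp only at this
  linarith

lemma unit_row {m : Type*} [Fintype m] [DecidableEq m] {U V : Matrix m m ℂ} 
    (hU : Uᴴ * U = 1) (hV : V * Vᴴ = 1) (i : m) :
    ∑ j, Complex.normSq ((Vᴴ * U) j i) = 1 := by
  have : ((Vᴴ * U)ᴴ * (Vᴴ * U)) i i = 1 := by
    have : (Vᴴ * U)ᴴ * (Vᴴ * U) = Uᴴ * (V * Vᴴ) * U := by
      simp only [Matrix.mul_assoc, Matrix.conjTranspose_mul, Matrix.conjTranspose_conjTranspose]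
    rw [this, hV, Matrix.mul_one, hU, Matrix.one_apply_eq]
  rw [Matrix.mul_apply] at this
  have h2 : ((∑ j, Complex.normSq ((Vᴴ * U) j i) : ℝ) : ℂ) = 1 := by
    rw [← this, Complex.ofReal_sum]
    refine Finset.sum_congr rfl fun j _ => ?_
    rw [Complex.normSq_eq_conj_mul_self, Matrix.conjTranspose_apply]; rfl
  exact_mod_cast h2

lemma spec_trace {m : Type*} [Fintype m] [DecidableEq m] {ρ U : Matrix m m ℂ} {p : m → ℝ}
    (hρ : Spec ρ U p) : ρ.trace = ((∑ i, p i : ℝ) : ℂ) := by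
  obtain ⟨hU, hU', rfl⟩ := hρ
  rw [Matrix.trace_mul_comm, ← Matrix.mul_assoc, hU, Matrix.one_mul, Matrix.trace_diagonal,
    Complex.ofReal_sum]

lemma Psi_zero {m : Type*} [Fintype m] [DecidableEq m] {ρ U V : Matrix m m ℂ} {p q : m → ℝ}
    (hρ : Spec ρ U p) : Psi U V p q 0 = ∑ j, ((Vᴴ * ρ * V) j j).re * Real.log (q j) := by
  unfold Psi
  rw [Finset.sum_comm]
  refine Finset.sum_congr rfl fun j _ => ?_
  obtain ⟨hU, hU', rfl⟩ := hρ
  have : Vᴴ * (U * Matrix.diagonal (fun i => (p i : ℂ)) * Uᴴ) * V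
      = (Vᴴ * U) * Matrix.diagonal (fun i => (p i : ℂ)) * (Vᴴ * U)ᴴ := by
    simp only [Matrix.mul_assoc, Matrix.conjTranspose_mul, Matrix.conjTranspose_conjTranspose]
  rw [this, Matrix.mul_apply, Complex.re_sum, Finset.sum_mul]
  refine Finset.sum_congr rfl fun i _ => ?_
  rw [Matrix.mul_diagonal, Matrix.conjTranspose_apply]
  generalize (Vᴴ * U) j i = c
  simp [Complex.normSq_apply, Complex.mul_re]
  ring

lemma Psi_lim {m : Type*} [Fintype m] [DecidableEq m] {ρ U V : Matrix m m ℂ} {p q : m → ℝ}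
    (hρ : Spec ρ U p) (hV : V * Vᴴ = 1) (hp : ∀ i, 0 ≤ p i) (hq : ∀ i, 0 < q i) :
    Filter.Tendsto (fun s => Psi U V p q s - (∑ i, p i) * Real.log s) Filter.atTop
      (nhds (∑ i, p i * Real.log (p i))) := by
  have h1 : ∀ f : m → ℝ, ∑ i, f i = ∑ i, ∑ j, Complex.normSq ((Vᴴ * U) j i) * f i := by
    intro f
    refine Finset.sum_congr rfl fun i _ => ?_
    rw [← Finset.sum_mul, unit_row hρ.1 hV, one_mul]
  have h2 : (fun s => Psi U V p q s - (∑ i, p i) * Real.log s) = fun s =>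
      ∑ i, ∑ j, Complex.normSq ((Vᴴ * U) j i) * (p i * (Real.log (q j + s * p i) - Real.log s)) := by
    funext s
    rw [Psi, Finset.sum_mul, h1 (fun i => p i * Real.log s), ← Finset.sum_sub_distrib]
    refine Finset.sum_congr rfl fun i _ => ?_
    rw [← Finset.sum_sub_distrib]
    refine Finset.sum_congr rfl fun j _ => ?_
    ring
  rw [h2, h1]
  refine tendsto_finsetSum _ fun i _ => tendsto_finsetSum _ fun j _ => ?_
  refine Filter.Tendsto.const_mul _ ?_
  rcases (hp i).eq_or_lt with h | h
  · simp [← h]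
  refine Filter.Tendsto.const_mul _ ?_
  have h3 : Filter.Tendsto (fun s : ℝ => q j * s⁻¹ + p i) Filter.atTop (nhds (p i)) := by
    simpa using (tendsto_inv_atTop_zero.const_mul (q j)).add_const (p i)
  refine (h3.log h.ne').congr' ?_
  filter_upwards [Filter.eventually_gt_atTop 0] with s hs
  rw [← Real.log_div _ hs.ne']
  · congr 1; field_simp
  · have := hq j; positivity

lemma relent_mono {X C : Type*} [Fintype X] [Fintype C] [DecidableEq C] [DecidableEq X]
    {ρ σ U V : Matrix (X × C) (X × C) ℂ} {p q : X × C → ℝ} {U' V' : Matrix X X ℂ} {p' q' : X → ℝ}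
    (hρ : Spec ρ U p) (hσ : Spec σ V q) (hp : ∀ i, 0 ≤ p i) (hq : ∀ i, 0 < q i)
    (hρ' : Spec (ptr ρ) U' p') (hσ' : Spec (ptr σ) V' q') (hp' : ∀ i, 0 ≤ p' i)
    (hq' : ∀ i, 0 < q' i) :
    ∑ i, p' i * Real.log (p' i) - ∑ j, ((V'ᴴ * ptr ρ * V') j j).re * Real.log (q' j) ≤ 
    ∑ i, p i * Real.log (p i) - ∑ j, ((Vᴴ * ρ * V) j j).re * Real.log (q j) := by
  rw [← Psi_zero (U := U') (q := q') hρ', ← Psi_zero (U := U) (q := q) hρ]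
  refine le_of_tendsto_of_tendsto ((Psi_lim hρ' hσ'.2.1 hp' hq').sub_const _)
    ((Psi_lim hρ hσ.2.1 hp hq).sub_const _) ?_
  have ht : ∑ i, p' i = ∑ i, p i := by
    have h1 := spec_trace hρ
    have h2 := spec_trace hρ'
    have h3 : (ptr ρ).trace = ρ.trace := by
      simp [Matrix.trace, ptr, Fintype.sum_prod_type]
    rw [h3, h1] at h2
    exact_mod_cast h2.symm
  filter_upwards [Filter.eventually_ge_atTop 0] with s hs
  have := Psi_mono hρ hσ hp hq hρ' hσ' hp' hq' hs
  simp only [ht]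
  linarith

lemma ent_spec {m : Type*} [Fintype m] [DecidableEq m] {ρ : Matrix m m ℂ} (h : ρ.PosSemidef) :
    ∃ (U : Matrix m m ℂ) (p : m → ℝ), Spec ρ U p ∧ (∀ i, 0 ≤ p i) ∧
      vnEntropy ρ = -∑ i, p i * Real.log (p i) := by
  refine ⟨h.1.eigenvectorUnitary, h.1.eigenvalues, ⟨?_, ?_, ?_⟩, h.eigenvalues_nonneg, ?_⟩
  · exact Unitary.coe_star_mul_self h.1.eigenvectorUnitary
  · exact Unitary.coe_mul_star_self h.1.eigenvectorUnitary
  · have := h.1.spectral_theorem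
    rw [Unitary.conjStarAlgAut_apply] at this
    exact this
  · rw [vnEntropy, dif_pos h.1]

lemma ent_roots {m : Type*} [Fintype m] [DecidableEq m] {ρ : Matrix m m ℂ} (h : ρ.IsHermitian) :
    vnEntropy ρ = -(ρ.charpoly.roots.map (fun z : ℂ => z.re * Real.log z.re)).sum := by
  rw [vnEntropy, dif_pos h, h.roots_charpoly_eq_eigenvalues, Multiset.map_map]
  refine congrArg Neg.neg ?_
  change _ = ∑ j, _
  refine Finset.sum_congr rfl fun j _ => ?_
  simp

lemma ent_submatrix {m n : Type*} [Fintype m] [DecidableEq m] [Fintype n] [DecidableEq n]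
    {ρ : Matrix m m ℂ} (h : ρ.IsHermitian) (e : n ≃ m) :
    vnEntropy (ρ.submatrix e e) = vnEntropy ρ := by
  rw [ent_roots h, ent_roots (h.submatrix e)]
  have := Matrix.charpoly_reindex e.symm ρ
  rw [Matrix.reindex_apply, Equiv.symm_symm] at this
  rw [this]

lemma ent_transpose {m : Type*} [Fintype m] [DecidableEq m]
    {ρ : Matrix m m ℂ} (h : ρ.IsHermitian) :
    vnEntropy ρᵀ = vnEntropy ρ := by
  rw [ent_roots h, ent_roots h.transpose, Matrix.charpoly_transpose]

lemma ent_mul_comm {m n : Type*} [Fintype m] [DecidableEq m] [Fintype n] [DecidableEq n]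
    (M : Matrix m n ℂ) : vnEntropy (M * Mᴴ) = vnEntropy (Mᴴ * M) := by
  rw [ent_roots (Matrix.isHermitian_mul_conjTranspose_self M),
    ent_roots (Matrix.isHermitian_conjTranspose_mul_self M)]
  have h := Matrix.charpoly_mul_comm' M Mᴴ
  have h2 := congrArg (fun P : Polynomial ℂ =>
    (P.roots.map (fun z : ℂ => z.re * Real.log z.re)).sum) h
  rw [Polynomial.roots_mul, Polynomial.roots_mul] at h2
  · simpa [Polynomial.roots_pow, Multiset.map_nsmul, Multiset.sum_nsmul] using h2
  · exact mul_ne_zero (pow_ne_zero _ Polynomial.X_ne_zero) (Matrix.charpoly_monic _).ne_zero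
  · exact mul_ne_zero (pow_ne_zero _ Polynomial.X_ne_zero) (Matrix.charpoly_monic _).ne_zero

/-- `1 ⊗ W`, entrywise. -/
def lift {m A B : Type*} [DecidableEq A] (e : m ≃ A × B) (W : Matrix B B ℂ) : Matrix m m ℂ :=
  fun i j => if (e i).1 = (e j).1 then W (e i).2 (e j).2 else 0

lemma lift_mul {m A B : Type*} [DecidableEq A] [Fintype m] [Fintype A] [Fintype B]
    (e : m ≃ A × B) (W W' : Matrix B B ℂ) : lift e W * lift e W' = lift e (W * W') := by
  ext i j
  rw [Matrix.mul_apply, ← e.symm.sum_comp, Fintype.sum_prod_type]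
  simp only [lift, Equiv.apply_symm_apply, Matrix.mul_apply]
  by_cases h : (e i).1 = (e j).1
  · simp [h, ← ite_and]
    rw [Finset.sum_eq_single (e j).1] <;> simp +contextual [eq_comm]
  · rw [if_neg h]
    refine Finset.sum_eq_zero fun a _ => Finset.sum_eq_zero fun b _ => ?_
    by_cases h1 : (e i).1 = a
    · subst h1; simp [h]
    · simp [h1]

lemma lift_conj {m A B : Type*} [DecidableEq A] 
    (e : m ≃ A × B) (W : Matrix B B ℂ) : (lift e W)ᴴ = lift e Wᴴ := by
  ext i j
  simp only [lift, Matrix.conjTranspose_apply]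
  by_cases h : (e i).1 = (e j).1
  · simp [h]
  · simp [h, Ne.symm h]

lemma lift_one {m A B : Type*} [DecidableEq A] [DecidableEq B] [DecidableEq m]
    (e : m ≃ A × B) : lift e (1 : Matrix B B ℂ) = 1 := by
  ext i j
  simp only [lift, Matrix.one_apply]
  rw [← ite_and]
  congr 1
  rw [← Prod.ext_iff, e.apply_eq_iff_eq]

lemma lift_diag {m A B : Type*} [DecidableEq A] [DecidableEq B] [DecidableEq m]
    (e : m ≃ A × B) (d : B → ℂ) :
    lift e (Matrix.diagonal d) = Matrix.diagonal (fun i => d (e i).2) := by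
  ext i j
  simp only [lift, Matrix.diagonal_apply]
  rw [← ite_and]
  congr 1
  rw [← Prod.ext_iff, e.apply_eq_iff_eq]

lemma spec_add {B : Type*} [DecidableEq B] [Fintype B] {τ W : Matrix B B ℂ} {r : B → ℝ}
    (h : Spec τ W r) (ε : ℝ) : Spec (τ + (ε : ℂ) • 1) W (fun i => r i + ε) := by
  refine ⟨h.1, h.2.1, ?_⟩
  have : Matrix.diagonal (fun i => ((r i + ε : ℝ) : ℂ)) =
      Matrix.diagonal (fun i => (r i : ℂ)) + (ε : ℂ) • (1 : Matrix B B ℂ) := by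
    ext i j
    by_cases hij : i = j
    · subst hij; simp
    · simp [hij]
  rw [this, Matrix.mul_add, Matrix.add_mul, ← h.2.2, Matrix.mul_smul, Matrix.smul_mul,
    Matrix.mul_one, h.2.1]

lemma spec_lift {m A B : Type*} [DecidableEq A] [DecidableEq B] [DecidableEq m]
    [Fintype m] [Fintype A] [Fintype B] (e : m ≃ A × B) {τ W : Matrix B B ℂ} {r : B → ℝ}
    (h : Spec τ W r) : Spec (lift e τ) (lift e W) (fun i => r (e i).2) := by
  refine ⟨?_, ?_, ?_⟩
  · rw [lift_conj, lift_mul, h.1, lift_one]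
  · rw [lift_conj, lift_mul, h.2.1, lift_one]
  · rw [lift_conj, ← lift_diag e (fun i => (r i : ℂ)), lift_mul, lift_mul, ← h.2.2]

lemma mul_lift {m A B : Type*} [DecidableEq A] [Fintype m] [Fintype A] [Fintype B]
    (e : m ≃ A × B) (M : Matrix m m ℂ) (W : Matrix B B ℂ) (i : m) (a : A) (b : B) :
    (M * lift e W) i (e.symm (a, b)) = ∑ b', M i (e.symm (a, b')) * W b' b := by
  rw [Matrix.mul_apply, ← e.symm.sum_comp, Fintype.sum_prod_type, Finset.sum_comm]
  refine Finset.sum_congr rfl fun b' _ => ?_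
  simp [lift]

lemma lift_mul' {m A B : Type*} [DecidableEq A] [Fintype m] [Fintype A] [Fintype B]
    (e : m ≃ A × B) (M : Matrix m m ℂ) (W : Matrix B B ℂ) (i : m) (a : A) (b : B) :
    (lift e W * M) (e.symm (a, b)) i = ∑ b', W b b' * M (e.symm (a, b')) i := by
  rw [Matrix.mul_apply, ← e.symm.sum_comp, Fintype.sum_prod_type, Finset.sum_comm]
  refine Finset.sum_congr rfl fun b' _ => ?_
  simp [lift]

lemma lift_sum {m A B : Type*} [DecidableEq A] [DecidableEq B] [DecidableEq m]
    [Fintype m] [Fintype A] [Fintype B] (e : m ≃ A × B) {ρ : Matrix m m ℂ} {τ W : Matrix B B ℂ}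
    {r : B → ℝ} (h : Spec τ W r)
    (hτ : ∀ b b', τ b b' = ∑ a, ρ (e.symm (a, b)) (e.symm (a, b'))) (g : B → ℝ) :
    ∑ j, (((lift e W)ᴴ * ρ * lift e W) j j).re * g (e j).2 = ∑ b, r b * g b := by
  have h1 : Wᴴ * τ * W = Matrix.diagonal (fun i => (r i : ℂ)) := by
    rw [h.2.2]
    have : Wᴴ * (W * Matrix.diagonal (fun i => (r i : ℂ)) * Wᴴ) * W =
      (Wᴴ * W) * Matrix.diagonal (fun i => (r i : ℂ)) * (Wᴴ * W) := by
      simp only [Matrix.mul_assoc]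
    rw [this, h.1, Matrix.one_mul, Matrix.mul_one]
  rw [← e.symm.sum_comp, Fintype.sum_prod_type, Finset.sum_comm]
  refine Finset.sum_congr rfl fun b _ => ?_
  simp only [Equiv.apply_symm_apply]
  rw [← Finset.sum_mul, ← Complex.re_sum]
  congr 1
  have h2 : (Wᴴ * τ * W) b b = (r b : ℂ) := by rw [h1]; simp
  rw [← Complex.ofReal_re (r b), ← h2]
  congr 1
  simp only [lift_conj, mul_lift, lift_mul']
  simp only [Matrix.mul_apply, hτ, Finset.sum_mul, Finset.mul_sum]
  rw [Finset.sum_comm]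
  refine Finset.sum_congr rfl fun x _ => ?_
  rw [Finset.sum_comm]

lemma lim_aux {B : Type*} [Fintype B] (r : B → ℝ) (hr : ∀ i, 0 ≤ r i) (c : ℝ) :
    Filter.Tendsto (fun ε : ℝ => ∑ b, r b * Real.log (r b + ε * c)) (nhdsWithin 0 (Set.Ioi 0))
      (nhds (∑ b, r b * Real.log (r b))) := by
  refine tendsto_finsetSum _ fun b _ => ?_
  rcases (hr b).eq_or_lt with h | h
  · simp [← h]
  refine Filter.Tendsto.const_mul _ ?_
  refine Filter.Tendsto.log ?_ h.ne'
  have : Filter.Tendsto (fun ε : ℝ => r b + ε * c) (nhds 0) (nhds (r b + 0 * c)) :=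
    Continuous.tendsto (by fun_prop) 0
  rw [zero_mul, add_zero] at this
  exact this.mono_left nhdsWithin_le_nhds

/-- Strong subadditivity. -/
lemma ssa {A B C : Type*} [Fintype A] [Fintype B] [Fintype C] [DecidableEq A] [DecidableEq B]
    [DecidableEq C] [Nonempty C] {ρ : Matrix ((A × B) × C) ((A × B) × C) ℂ} {ρAB : Matrix (A × B) (A × B) ℂ}
    {ρBC : Matrix (B × C) (B × C) ℂ} {ρB : Matrix B B ℂ}
    (h : ρ.PosSemidef) (hAB : ρAB.PosSemidef) (hBC : ρBC.PosSemidef) (hB : ρB.PosSemidef)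
    (eAB : ∀ x y, ρAB x y = ∑ c, ρ (x, c) (y, c))
    (eBC : ∀ x y, ρBC x y = ∑ a, ρ ((a, x.1), x.2) ((a, y.1), y.2))
    (eB : ∀ x y, ρB x y = ∑ a, ∑ c, ρ ((a, x), c) ((a, y), c)) :
    vnEntropy ρ + vnEntropy ρB ≤ vnEntropy ρAB + vnEntropy ρBC := by
  obtain ⟨U, p, hs, hp, he⟩ := ent_spec h
  obtain ⟨U', p', hs', hp', he'⟩ := ent_spec hAB
  obtain ⟨W, r, hW, hr, hre⟩ := ent_spec hBC
  obtain ⟨W', r', hW', hr', hre'⟩ := ent_spec hB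
  have e1 : ptr ρ = ρAB := by ext x y; rw [eAB]; rfl
  obtain ⟨d, hd⟩ : ∃ d : ℝ, d = (Fintype.card C : ℝ) := ⟨_, rfl⟩
  have hdpos : 0 < d := by rw [hd]; exact_mod_cast Fintype.card_pos
  have key : ∀ ε : ℝ, 0 < ε →
      ∑ i, p' i * Real.log (p' i) - ∑ b, r' b * Real.log (r' b + ε * d) ≤
      ∑ i, p i * Real.log (p i) - ∑ b, r b * Real.log (r b + ε * 1) := by
    intro ε hε
    have s1 := spec_lift (Equiv.prodAssoc A B C) (spec_add hW (ε * 1))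
    have s2 := spec_lift (Equiv.refl (A × B)) (spec_add hW' (ε * d))
    have e2 : ptr (lift (Equiv.prodAssoc A B C) (ρBC + ((ε * 1 : ℝ) : ℂ) • 1)) =
        lift (Equiv.refl (A × B)) (ρB + ((ε * d : ℝ) : ℂ) • 1) := by
      ext ⟨a, b⟩ ⟨a', b'⟩
      simp only [ptr, lift, Equiv.prodAssoc_apply, Equiv.refl_apply, Matrix.add_apply,
        Matrix.smul_apply, Matrix.one_apply, eBC, eB, Prod.mk.injEq, and_true]
      by_cases haa : a = a'
      · simp only [haa, if_true, Finset.sum_add_distrib]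
        rw [Finset.sum_comm]
        congr 1
        by_cases hb : b = b'
        · simp [hb, hd, mul_comm]
        · simp [hb]
      · simp [haa]
    rw [← e1] at hs'
    rw [← e2] at s2
    have := relent_mono hs s1 hp (fun i => by have := hr (Equiv.prodAssoc A B C i).2; linarith)
      hs' s2 hp' (fun i => by
        have := hr' (Equiv.refl (A × B) i).2
        have := mul_pos hε hdpos
        linarith)
    rw [lift_sum (Equiv.prodAssoc A B C) hW (fun b b' => by rw [eBC]; rfl)
      (fun b => Real.log (r b + ε * 1)),
      lift_sum (Equiv.refl (A × B)) hW' (fun b b' => by rw [eB]; rfl)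
      (fun b => Real.log (r' b + ε * d))] at this
    exact this
  have := le_of_tendsto_of_tendsto ((lim_aux r' hr' d).const_sub (∑ i, p' i * Real.log (p' i)))
    ((lim_aux r hr 1).const_sub (∑ i, p i * Real.log (p i)))
    (Filter.eventually_of_mem self_mem_nhdsWithin key)
  rw [he, he', hre, hre']
  linarith

/-- Weak monotonicity for a pure state. -/
lemma wm_pure {F A B R : Type*} [Fintype F] [Fintype A] [Fintype B] [Fintype R] [DecidableEq F]
    [DecidableEq A] [DecidableEq B] [DecidableEq R] [Nonempty R] (Ψ : F → A → B → R → ℂ) :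
    vnEntropy (Matrix.of fun x y : A => ∑ f, ∑ b, ∑ r, Ψ f x b r * star (Ψ f y b r)) +
    vnEntropy (Matrix.of fun x y : B => ∑ f, ∑ a, ∑ r, Ψ f a x r * star (Ψ f a y r)) ≤
    vnEntropy (Matrix.of fun x y : F × A => ∑ b, ∑ r, Ψ x.1 x.2 b r * star (Ψ y.1 y.2 b r)) +
    vnEntropy (Matrix.of fun x y : F × B => ∑ a, ∑ r, Ψ x.1 a x.2 r * star (Ψ y.1 a y.2 r)) := by
  let M : Matrix ((F × A) × R) B ℂ := Matrix.of fun x b => Ψ x.1.1 x.1.2 b x.2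
  let N : Matrix (A × R) (F × B) ℂ := Matrix.of fun x y => Ψ y.1 x.1 y.2 x.2
  let P : Matrix (F × A) (B × R) ℂ := Matrix.of fun x y => Ψ x.1 x.2 y.1 y.2
  let Q : Matrix A (F × B × R) ℂ := Matrix.of fun x y => Ψ y.1 x y.2.1 y.2.2
  have hQ : (Matrix.of fun x y : A => ∑ f, ∑ b, ∑ r, Ψ f x b r * star (Ψ f y b r)) = Q * Qᴴ := by
    ext x y
    simp [Matrix.mul_apply, Q, Matrix.of_apply, Fintype.sum_prod_type]
  have hP : (Matrix.of fun x y : F × A => ∑ b, ∑ r, Ψ x.1 x.2 b r * star (Ψ y.1 y.2 b r))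
      = P * Pᴴ := by
    ext x y
    simp [Matrix.mul_apply, P, Matrix.of_apply, Fintype.sum_prod_type]
  have hM : (Matrix.of fun x y : B => ∑ f, ∑ a, ∑ r, Ψ f a x r * star (Ψ f a y r))
      = (Mᴴ * M)ᵀ := by
    ext x y
    simp [Matrix.mul_apply, M, Matrix.of_apply, Fintype.sum_prod_type, mul_comm]
  have hN : (Matrix.of fun x y : F × B => ∑ a, ∑ r, Ψ x.1 a x.2 r * star (Ψ y.1 a y.2 r))
      = (Nᴴ * N)ᵀ := by
    ext x y
    simp [Matrix.mul_apply, N, Matrix.of_apply, Fintype.sum_prod_type, mul_comm]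
  rw [hQ, hP, hM, hN, ent_transpose (Matrix.isHermitian_conjTranspose_mul_self M),
    ent_transpose (Matrix.isHermitian_conjTranspose_mul_self N), ← ent_mul_comm, ← ent_mul_comm,
    add_comm]
  refine ssa (Matrix.posSemidef_self_mul_conjTranspose M)
    (Matrix.posSemidef_self_mul_conjTranspose P) (Matrix.posSemidef_self_mul_conjTranspose N)
    (Matrix.posSemidef_self_mul_conjTranspose Q) ?_ ?_ ?_
  · intro x y
    simp only [Matrix.mul_apply, M, P, Matrix.conjTranspose_apply, Fintype.sum_prod_type]
    rw [Finset.sum_comm]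
    rfl
  · intro x y
    simp only [Matrix.mul_apply, M, N, Matrix.conjTranspose_apply, Fintype.sum_prod_type]
    rfl
  · intro x y
    simp only [Matrix.mul_apply, M, Q, Matrix.conjTranspose_apply, Fintype.sum_prod_type]
    refine Finset.sum_congr rfl fun f _ => ?_
    rw [Finset.sum_comm]
    rfl

/-- Weak monotonicity. -/
lemma wm {T F A B C : Type*} [Fintype T] [DecidableEq T] [Fintype F] [Fintype A] [Fintype B]
    [Fintype C] [DecidableEq F] [DecidableEq A] [DecidableEq B] [DecidableEq C] [Nonempty C]
    [Nonempty T] {ρ : Matrix T T ℂ} (h : ρ.PosSemidef) (E : F → A → B → C → T) :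
    vnEntropy (Matrix.of fun x x' : A => ∑ y : F × B × C,
      ρ (E y.1 x y.2.1 y.2.2) (E y.1 x' y.2.1 y.2.2)) +
    vnEntropy (Matrix.of fun x x' : B => ∑ y : F × A × C,
      ρ (E y.1 y.2.1 x y.2.2) (E y.1 y.2.1 x' y.2.2)) ≤
    vnEntropy (Matrix.of fun x x' : F × A => ∑ y : B × C,
      ρ (E x.1 x.2 y.1 y.2) (E x'.1 x'.2 y.1 y.2)) +
    vnEntropy (Matrix.of fun x x' : F × B => ∑ y : A × C,
      ρ (E x.1 y.1 x.2 y.2) (E x'.1 y.1 x'.2 y.2)) := by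
  obtain ⟨K, hK⟩ : ∃ K : Matrix T T ℂ, ρ = K * Kᴴ := by
    obtain ⟨U, p, hs, hp, -⟩ := ent_spec h
    refine ⟨U * Matrix.diagonal (fun i => ((Real.sqrt (p i) : ℝ) : ℂ)), ?_⟩
    have h1 : Matrix.diagonal (fun i => (p i : ℂ)) =
        Matrix.diagonal (fun i => ((Real.sqrt (p i) : ℝ) : ℂ)) *
        (Matrix.diagonal (fun i => ((Real.sqrt (p i) : ℝ) : ℂ)))ᴴ := by
      rw [Matrix.diagonal_conjTranspose, Matrix.diagonal_mul_diagonal]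
      congr 1
      funext i
      simp only [Pi.star_apply, Complex.star_def, Complex.conj_ofReal]
      rw [← Complex.ofReal_mul, Real.mul_self_sqrt (hp i)]
    rw [hs.2.2, h1, Matrix.conjTranspose_mul]
    simp only [Matrix.mul_assoc]
  have := wm_pure (fun f a b (r : C × T) => K (E f a b r.1) r.2)
  simpa only [hK, Matrix.mul_apply, Fintype.sum_prod_type, Matrix.conjTranspose_apply] using this

lemma link {ι : Type*} [Fintype ι] [DecidableEq ι] {dim : ι → ℕ}
    {ρ : Matrix ((i : ι) → Fin (dim i)) ((i : ι) → Fin (dim i)) ℂ} (hρ : ρ.IsHermitian)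
    (S : Finset ι) {X Y : Type*} [Fintype X] [Fintype Y] [DecidableEq X]
    (mk : X → Y → ((i : ι) → Fin (dim i)))
    (hb : Function.Bijective (fun z : X × Y => mk z.1 z.2)) (x₀ : X) (y₀ : Y)
    (h1 : ∀ i ∈ S, ∀ x y y', mk x y i = mk x y' i)
    (h2 : ∀ i ∉ S, ∀ x x' y, mk x y i = mk x' y i) :
    mEnt ρ S = vnEntropy (Matrix.of fun x x' : X => ∑ y : Y, ρ (mk x y) (mk x' y)) := by
  let rX : X → ((i : {j : ι // j ∈ S}) → Fin (dim i.1)) := fun x i => mk x y₀ i.1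
  let rY : Y → ((i : {j : ι // j ∉ S}) → Fin (dim i.1)) := fun y i => mk x₀ y i.1
  have hglue : ∀ x y, (fun i => if h : i ∈ S then rX x ⟨i, h⟩ else rY y ⟨i, h⟩) = mk x y := by
    intro x y
    funext i
    by_cases h : i ∈ S
    · simp only [h, dif_pos, rX]; exact h1 i h _ _ _
    · simp only [h, rY]; exact h2 i h _ _ _
  have hX : Function.Bijective rX := by
    constructor
    · intro x x' hx
      have : mk x y₀ = mk x' y₀ := by rw [← hglue, ← hglue, hx]
      exact congrArg Prod.fst (hb.1 (a₁ := (x, y₀)) (a₂ := (x', y₀)) this)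
    · intro u
      obtain ⟨⟨x, y⟩, hxy⟩ := hb.2 (fun i => if h : i ∈ S then u ⟨i, h⟩ else rY y₀ ⟨i, h⟩)
      refine ⟨x, ?_⟩
      funext i
      have := congrFun hxy i.1
      simp only [i.2, dif_pos] at this
      rw [← this]
      exact h1 i.1 i.2 _ _ _
  have hY : Function.Bijective rY := by
    constructor
    · intro y y' hx
      have : mk x₀ y = mk x₀ y' := by rw [← hglue, ← hglue, hx]
      exact congrArg Prod.snd (hb.1 (a₁ := (x₀, y)) (a₂ := (x₀, y')) this)
    · intro u
      obtain ⟨⟨x, y⟩, hxy⟩ := hb.2 (fun i => if h : i ∈ S then rX x₀ ⟨i, h⟩ else u ⟨i, h⟩)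
      refine ⟨y, ?_⟩
      funext i
      have := congrFun hxy i.1
      simp only [i.2] at this
      refine Eq.trans ?_ this
      exact h2 i.1 i.2 _ _ _
  have hm : (marginal ρ S).IsHermitian := by
    ext x y
    simp only [marginal, Matrix.conjTranspose_apply, star_sum]
    exact Finset.sum_congr rfl fun z _ => hρ.apply _ _
  rw [mEnt, ← ent_submatrix hm (Equiv.ofBijective rX hX)]
  congr 1
  ext x x'
  simp only [Matrix.submatrix_apply, Equiv.ofBijective_apply, marginal, Matrix.of_apply]
  rw [← (Equiv.ofBijective rY hY).sum_comp]
  simp only [Equiv.ofBijective_apply, hglue]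

/-- gluing map -/
def glue {n : ℕ} {dim : Fin n ⊕ Unit → ℕ} (J J' : Finset (Fin n)) (f : Fin (dim (Sum.inr ())))
    (a : (i : {i // i ∈ J}) → Fin (dim (Sum.inl i.1)))
    (b : (i : {i // i ∈ J'}) → Fin (dim (Sum.inl i.1)))
    (c : (i : {i // i ∉ J ∧ i ∉ J'}) → Fin (dim (Sum.inl i.1))) :
    (i : Fin n ⊕ Unit) → Fin (dim i)
  | Sum.inl i => if h : i ∈ J then a ⟨i, h⟩ else if h' : i ∈ J' then b ⟨i, h'⟩ else c ⟨i, h, h'⟩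
  | Sum.inr () => f

lemma glue_bij {n : ℕ} {dim : Fin n ⊕ Unit → ℕ} (J J' : Finset (Fin n)) (hd : Disjoint J J') :
    Function.Bijective (fun z : Fin (dim (Sum.inr ())) ×
    ((i : {i // i ∈ J}) → Fin (dim (Sum.inl i.1))) ×
    ((i : {i // i ∈ J'}) → Fin (dim (Sum.inl i.1))) ×
    ((i : {i // i ∉ J ∧ i ∉ J'}) → Fin (dim (Sum.inl i.1))) =>
      glue J J' z.1 z.2.1 z.2.2.1 z.2.2.2) := by
  have hd' : ∀ i ∈ J', i ∉ J := fun i hi hj => Finset.disjoint_left.1 hd hj hi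
  refine Function.bijective_iff_has_inverse.2 ⟨fun t => (t (Sum.inr ()), fun i => t (Sum.inl i.1),
    fun i => t (Sum.inl i.1), fun i => t (Sum.inl i.1)), ?_, ?_⟩
  · rintro ⟨f, a, b, c⟩
    refine Prod.ext rfl (Prod.ext ?_ (Prod.ext ?_ ?_))
    · funext i; simp [glue, i.2]
    · funext i; simp [glue, i.2, hd' i.1 i.2]
    · funext i; simp [glue, i.2.1, i.2.2]
  · intro t
    funext i
    rcases i with i | i
    · by_cases h : i ∈ J
      · simp [glue, h]
      · by_cases h' : i ∈ J' <;> simp [glue, h, h']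
    · rfl

lemma pair {n : ℕ} {dim : Fin n ⊕ Unit → ℕ}
    {ρ : Matrix ((i : Fin n ⊕ Unit) → Fin (dim i)) ((i : Fin n ⊕ Unit) → Fin (dim i)) ℂ}
    (hpsd : ρ.PosSemidef) (t₀ : (i : Fin n ⊕ Unit) → Fin (dim i))
    (J J' : Finset (Fin n)) (hd : Disjoint J J') :
    0 ≤ (mEnt ρ (({Sum.inr ()} : Finset (Fin n ⊕ Unit)) ∪ J.image Sum.inl)
            - mEnt ρ (J.image Sum.inl)) +
        (mEnt ρ (({Sum.inr ()} : Finset (Fin n ⊕ Unit)) ∪ J'.image Sum.inl)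
            - mEnt ρ (J'.image Sum.inl)) := by
  have hd' : ∀ i ∈ J', i ∉ J := fun i hi hj => Finset.disjoint_left.1 hd hj hi
  have hb := glue_bij (dim := dim) J J' hd
  obtain ⟨⟨f₀, a₀, b₀, c₀⟩, -⟩ := hb.2 t₀
  have : Nonempty ((i : Fin n ⊕ Unit) → Fin (dim i)) := ⟨t₀⟩
  have : Nonempty ((i : {i // i ∉ J ∧ i ∉ J'}) → Fin (dim (Sum.inl i.1))) := ⟨c₀⟩
  have key := wm hpsd (glue J J')
  rw [← link hpsd.1 (J.image Sum.inl) (fun x y => glue J J' y.1 x y.2.1 y.2.2)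
      (hb.comp (Equiv.bijective ⟨fun z => (z.2.1, z.1, z.2.2.1, z.2.2.2),
        fun z => (z.2.1, z.1, z.2.2.1, z.2.2.2), fun _ => rfl, fun _ => rfl⟩)) a₀ (f₀, b₀, c₀) ?_ ?_,
    ← link hpsd.1 (J'.image Sum.inl) (fun x y => glue J J' y.1 y.2.1 x y.2.2)
      (hb.comp (Equiv.bijective ⟨fun z => (z.2.1, z.2.2.1, z.1, z.2.2.2),
        fun z => (z.2.2.1, z.1, z.2.1, z.2.2.2), fun _ => rfl, fun _ => rfl⟩)) b₀ (f₀, a₀, c₀) ?_ ?_,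
    ← link hpsd.1 (({Sum.inr ()} : Finset (Fin n ⊕ Unit)) ∪ J.image Sum.inl)
      (fun x y => glue J J' x.1 x.2 y.1 y.2)
      (hb.comp (Equiv.bijective ⟨fun z => (z.1.1, z.1.2, z.2.1, z.2.2),
        fun z => ((z.1, z.2.1), (z.2.2.1, z.2.2.2)), fun _ => rfl, fun _ => rfl⟩))
        (f₀, a₀) (b₀, c₀) ?_ ?_,
    ← link hpsd.1 (({Sum.inr ()} : Finset (Fin n ⊕ Unit)) ∪ J'.image Sum.inl)
      (fun x y => glue J J' x.1 y.1 x.2 y.2)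
      (hb.comp (Equiv.bijective ⟨fun z => (z.1.1, z.2.1, z.1.2, z.2.2),
        fun z => ((z.1, z.2.2.1), (z.2.1, z.2.2.2)), fun _ => rfl, fun _ => rfl⟩))
        (f₀, b₀) (a₀, c₀) ?_ ?_] at key
  · linarith
  all_goals
    clear key hb
    rintro (i | i) hi
    · by_cases h : i ∈ J
      · have h' : i ∉ J' := fun h' => hd' i h' h
        simp [glue, h, h'] at hi ⊢
      · by_cases h' : i ∈ J' <;> simp [glue, h, h'] at hi ⊢
    · simp [glue] at hi ⊢

lemma average {n μ : ℕ} (hμn : 2 * μ ≤ n) (c : Finset (Fin n) → ℝ)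
    (hc : ∀ J J', Disjoint J J' → 0 ≤ c J + c J') :
    0 ≤ ∑ J ∈ Finset.powersetCard μ (Finset.univ : Finset (Fin n)), c J := by
  classical
  set P := Finset.powersetCard μ (Finset.univ : Finset (Fin n)) with hP
  have hcard : ∀ J ∈ P, (∑ J' ∈ P, if Disjoint J J' then (1 : ℝ) else 0)
      = ((n - μ).choose μ : ℝ) := by
    intro J hJ
    rw [Finset.sum_boole]
    have : P.filter (fun J' => Disjoint J J') = Finset.powersetCard μ Jᶜ := by
      ext K
      simp only [hP, Finset.mem_filter, Finset.mem_powersetCard, Finset.subset_univ, true_and]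
      rw [← Finset.subset_compl_iff_disjoint_left, and_comm]
    rw [this, Finset.card_powersetCard, Finset.card_compl, Fintype.card_fin,
      (Finset.mem_powersetCard.1 hJ).2]
  have h1 : 0 ≤ ∑ J ∈ P, ∑ J' ∈ P, (if Disjoint J J' then (1 : ℝ) else 0) * (c J + c J') := by
    refine Finset.sum_nonneg fun J _ => Finset.sum_nonneg fun J' _ => ?_
    by_cases h : Disjoint J J'
    · simpa [h] using hc J J' h
    · simp [h]
  have h2 : ∑ J ∈ P, ∑ J' ∈ P, (if Disjoint J J' then (1 : ℝ) else 0) * c J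
      = ((n - μ).choose μ : ℝ) * ∑ J ∈ P, c J := by
    rw [Finset.mul_sum]
    refine Finset.sum_congr rfl fun J hJ => ?_
    rw [← Finset.sum_mul, hcard J hJ]
  have h3 : ∑ J ∈ P, ∑ J' ∈ P, (if Disjoint J J' then (1 : ℝ) else 0) * c J'
      = ((n - μ).choose μ : ℝ) * ∑ J ∈ P, c J := by
    rw [Finset.sum_comm, ← h2]
    simp only [disjoint_comm]
  simp only [mul_add, Finset.sum_add_distrib, h2, h3] at h1
  have hpos : (0 : ℝ) < ((n - μ).choose μ : ℝ) := by
    exact_mod_cast Nat.choose_pos (by omega)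
  by_contra hneg
  push Not at hneg
  nlinarith [mul_pos hpos (neg_pos.2 hneg)]

end SSA

/-- on `F ⊗ X_1 ⊗ ⋯ ⊗ X_n` (`F = Sum.inr ()`), if `1 ≤ μ` and
`2μ ≤ n` then `E_{|J|=μ} S(F|X_J) ≥ 0`. -/
theorem avg_cond_entropy_F_nonneg
    (n μ : ℕ) (hμ : 1 ≤ μ) (hμn : 2 * μ ≤ n)
    (dim : Fin n ⊕ Unit → ℕ)
    (ρ : Matrix ((i : Fin n ⊕ Unit) → Fin (dim i))
                ((i : Fin n ⊕ Unit) → Fin (dim i)) ℂ)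
    (hpsd : ρ.PosSemidef) (htr : ρ.trace = 1) :
    0 ≤ (∑ J ∈ Finset.powersetCard μ (Finset.univ : Finset (Fin n)),
          (mEnt ρ (({Sum.inr ()} : Finset (Fin n ⊕ Unit)) ∪ J.image Sum.inl)
            - mEnt ρ (J.image Sum.inl)))
        / (n.choose μ : ℝ) := by
  refine div_nonneg (SSA.average hμn _ fun J J' hJ => ?_) (Nat.cast_nonneg _)
  have hne : Nonempty ((i : Fin n ⊕ Unit) → Fin (dim i)) := by
    by_contra hemp
    rw [not_nonempty_iff] at hemp
    simp [Matrix.trace] at htr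
  obtain ⟨t₀⟩ := hne
  exact SSA.pair hpsd t₀ J J' hJ
end

section
/- Entropic quantum Singleton bound. Let n, d, K, q be integers with q ≥ 2, K ≥ 1, d ≥ 2, and 2(d−1) < n. Let ψ be a pure quantum state on R ⊗ X_1 ⊗ … ⊗ X_n, where R has dimension K and each X_i has dimension q, whose marginal on R is the maximally mixed state (1/K)·Id_K. Suppose that for every partition {1,…,n} = I ∪ J with |I| = n−d+1 and |J| = d−1, the entropy equality S(X_I)_ψ = S(R)_ψ + S(X_J)_ψ holds. Then log K ≤ (n−2d+2)·σ̄ ≤ (n−2d+2)·log q, where σ̄ := (1/(d−1))·E_{|J|=d−1} S(X_J)_ψ is the average entropy per system of a random (d−1)-element block. -/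
open scoped BigOperators ComplexOrder

lemma log_compare {K L : Type*} [Fintype K] [Fintype L] (c x : K → ℝ) (c' x' : L → ℝ)
    (hx : ∀ k, 0 < x k) (hx' : ∀ k, 0 < x' k) (hsum : ∑ k, c k = ∑ k, c' k)
    (h : ∀ t : ℝ, 0 < t → ∑ k, c' k / (x' k + t) ≤ ∑ k, c k / (x k + t)) :
    ∑ k, c k * Real.log (x k) ≤ ∑ k, c' k * Real.log (x' k) := by
  set φ : ℝ → ℝ := fun T => ∑ k, c k * Real.log (x k + T) - ∑ k, c' k * Real.log (x' k + T)
    with hφ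
  have hder : ∀ T : ℝ, 0 ≤ T → HasDerivAt φ
      (∑ k, c k / (x k + T) - ∑ k, c' k / (x' k + T)) T := by
    intro T hT
    refine HasDerivAt.sub ?_ ?_
    · refine HasDerivAt.fun_sum fun k _ => ?_
      have h1 : HasDerivAt (fun T => x k + T) 1 T := (hasDerivAt_id T).const_add (x k)
      have := (h1.log (by have := hx k; positivity)).const_mul (c k)
      simpa [div_eq_mul_inv] using this
    · refine HasDerivAt.fun_sum fun k _ => ?_
      have h1 : HasDerivAt (fun T => x' k + T) 1 T := (hasDerivAt_id T).const_add (x' k)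
      have := (h1.log (by have := hx' k; positivity)).const_mul (c' k)
      simpa [div_eq_mul_inv] using this
  have hmono : MonotoneOn φ (Set.Ici 0) := by
    apply monotoneOn_of_deriv_nonneg (convex_Ici 0)
    · exact fun T hT => (hder T hT).continuousAt.continuousWithinAt
    · intro T hT
      rw [interior_Ici] at hT
      exact (hder T (le_of_lt hT)).differentiableAt.differentiableWithinAt
    · intro T hT
      rw [interior_Ici] at hT
      rw [(hder T (le_of_lt hT)).deriv]
      have := h T hT
      linarith
  have hlim : Filter.Tendsto φ Filter.atTop (nhds 0) := by
    have h1 : φ = fun T => ∑ k, c k * (Real.log (T + x k) - Real.log T)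
        - ∑ k, c' k * (Real.log (T + x' k) - Real.log T) := by
      funext T
      simp only [hφ, mul_sub, Finset.sum_sub_distrib, ← Finset.sum_mul, hsum, add_comm T]
      ring
    rw [h1]
    have h2 : ∀ {K : Type _} [Fintype K] (c x : K → ℝ), Filter.Tendsto
        (fun T => ∑ k, c k * (Real.log (T + x k) - Real.log T)) Filter.atTop (nhds 0) := by
      intro K _ c x
      have : Filter.Tendsto
        (fun T => ∑ k, c k * (Real.log (T + x k) - Real.log T)) Filter.atTop
          (nhds (∑ k, c k * 0)) :=
        tendsto_finsetSum _ fun k _ =>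
          (Real.tendsto_log_comp_add_sub_log (x k)).const_mul (c k)
      simpa using this
    have h3 : Filter.Tendsto
        (fun T => ∑ k, c' k * (Real.log (T + x' k) - Real.log T)) Filter.atTop (nhds 0) := by
      have : Filter.Tendsto
        (fun T => ∑ k, c' k * (Real.log (T + x' k) - Real.log T)) Filter.atTop
          (nhds (∑ k, c' k * 0)) :=
        tendsto_finsetSum _ fun k _ =>
          (Real.tendsto_log_comp_add_sub_log (x' k)).const_mul (c' k)
      simpa using this
    simpa using (h2 c x).sub h3
  have h0 : φ 0 ≤ 0 := by
    refine ge_of_tendsto hlim ?_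
    filter_upwards [Filter.eventually_ge_atTop 0] with T hT
    exact hmono (by simp) hT hT
  simp only [hφ, add_zero] at h0
  linarith

open Matrix in
/-- the quadratic functional whose supremum is the resolvent quantity -/
noncomputable def Qf {m : Type*} [Fintype m] (ρ σ X : Matrix m m ℂ) (t : ℝ) : ℝ :=
  (2 * (Xᴴ * ρ).trace - (Xᴴ * σ * X).trace - (t : ℂ) * (X * ρ * Xᴴ).trace).re

open Matrix in
lemma Qf_eq {m n l : Type*} [Fintype m] [Fintype n] [Fintype l]
    [DecidableEq m] [DecidableEq n] [DecidableEq l]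
    (U : Matrix m n ℂ) (V : Matrix m l ℂ) (p : n → ℝ) (q : l → ℝ)
    (hU : Uᴴ * U = 1) (hV : Vᴴ * V = 1) (x : Matrix l n ℂ) (t : ℝ) :
    Qf (U * diagonal (fun i => (p i : ℂ)) * Uᴴ) (V * diagonal (fun i => (q i : ℂ)) * Vᴴ)
      (V * x * Uᴴ) t =
    ∑ j, ∑ i, (2 * p i * (star (x j i) * (Vᴴ * U) j i).re
      - (q j + t * p i) * Complex.normSq (x j i)) := by
  have e1 : ((V * x * Uᴴ)ᴴ * (U * diagonal (fun i => (p i : ℂ)) * Uᴴ)).trace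
      = (xᴴ * (Vᴴ * U) * diagonal (fun i => (p i : ℂ))).trace := by
    rw [conjTranspose_mul, conjTranspose_mul, conjTranspose_conjTranspose, trace_mul_comm]
    simp only [Matrix.mul_assoc]
    rw [← Matrix.mul_assoc Uᴴ U, hU, Matrix.one_mul, trace_mul_comm]
    simp only [Matrix.mul_assoc]
    rw [← trace_mul_comm]
    simp only [Matrix.mul_assoc]
  have e2 : ((V * x * Uᴴ)ᴴ * (V * diagonal (fun i => (q i : ℂ)) * Vᴴ) * (V * x * Uᴴ)).trace
      = (xᴴ * diagonal (fun i => (q i : ℂ)) * x).trace := by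
    rw [conjTranspose_mul, conjTranspose_mul, conjTranspose_conjTranspose]
    have : U * (xᴴ * Vᴴ) * (V * diagonal (fun i => (q i : ℂ)) * Vᴴ) * (V * x * Uᴴ)
      = U * (xᴴ * (Vᴴ * V) * diagonal (fun i => (q i : ℂ)) * (Vᴴ * V) * x * Uᴴ) := by
      simp only [Matrix.mul_assoc]
    rw [this, hV, trace_mul_comm, Matrix.mul_assoc _ Uᴴ U, hU]
    simp only [Matrix.mul_one]
  have e3 : ((V * x * Uᴴ) * (U * diagonal (fun i => (p i : ℂ)) * Uᴴ) * (V * x * Uᴴ)ᴴ).trace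
      = (x * diagonal (fun i => (p i : ℂ)) * xᴴ).trace := by
    rw [conjTranspose_mul, conjTranspose_mul, conjTranspose_conjTranspose]
    have : V * x * Uᴴ * (U * diagonal (fun i => (p i : ℂ)) * Uᴴ) * (U * (xᴴ * Vᴴ))
      = V * (x * (Uᴴ * U) * diagonal (fun i => (p i : ℂ)) * (Uᴴ * U) * xᴴ * Vᴴ) := by
      simp only [Matrix.mul_assoc]
    rw [this, hU, trace_mul_comm, Matrix.mul_assoc _ Vᴴ V, hV]
    simp only [Matrix.mul_one]
  unfold Qf
  rw [e1, e2, e3]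
  generalize Vᴴ * U = W
  have f1 : (xᴴ * W * diagonal (fun i => (p i : ℂ))).trace
      = ∑ j, ∑ i, star (x j i) * W j i * (p i : ℂ) := by
    rw [Finset.sum_comm]
    refine Finset.sum_congr rfl fun i _ => ?_
    rw [diag_apply, mul_diagonal, Matrix.mul_apply, Finset.sum_mul]
    rfl
  have f2 : (xᴴ * diagonal (fun i => (q i : ℂ)) * x).trace
      = ∑ j, ∑ i, star (x j i) * (q j : ℂ) * x j i := by
    rw [Finset.sum_comm]
    refine Finset.sum_congr rfl fun i _ => ?_
    rw [diag_apply, Matrix.mul_apply]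
    simp only [mul_diagonal]
    rfl
  have f3 : (x * diagonal (fun i => (p i : ℂ)) * xᴴ).trace
      = ∑ j, ∑ i, x j i * (p i : ℂ) * star (x j i) := by
    refine Finset.sum_congr rfl fun i _ => ?_
    rw [diag_apply, Matrix.mul_apply]
    simp only [mul_diagonal]
    rfl
  rw [f1, f2, f3]
  simp only [Finset.mul_sum]
  simp only [← Finset.sum_sub_distrib, Complex.re_sum]
  refine Finset.sum_congr rfl fun j _ => Finset.sum_congr rfl fun i _ => ?_
  simp [Complex.normSq_apply]
  ring

open Matrix in
lemma Qf_le {m n l : Type*} [Fintype m] [Fintype n] [Fintype l]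
    [DecidableEq m] [DecidableEq n] [DecidableEq l]
    (U : Matrix m n ℂ) (V : Matrix m l ℂ) (p : n → ℝ) (q : l → ℝ)
    (hU : Uᴴ * U = 1) (hV : Vᴴ * V = 1) (hU' : U * Uᴴ = 1) (hV' : V * Vᴴ = 1)
    (hp : ∀ i, 0 ≤ p i) (hq : ∀ i, 0 ≤ q i) (X : Matrix m m ℂ) (t : ℝ) (ht : 0 < t) :
    Qf (U * diagonal (fun i => (p i : ℂ)) * Uᴴ) (V * diagonal (fun i => (q i : ℂ)) * Vᴴ) X t ≤
    ∑ j, ∑ i, Complex.normSq ((Vᴴ * U) j i) * p i ^ 2 / (q j + t * p i) := by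
  have hX : X = V * (Vᴴ * X * U) * Uᴴ := by
    have : V * (Vᴴ * X * U) * Uᴴ = (V * Vᴴ) * X * (U * Uᴴ) := by
      simp only [Matrix.mul_assoc]
    rw [this, hU', hV']; simp
  rw [hX, Qf_eq U V p q hU hV]
  refine Finset.sum_le_sum fun j _ => Finset.sum_le_sum fun i _ => ?_
  generalize (Vᴴ * X * U) j i = y
  generalize (Vᴴ * U) j i = w
  rcases (hp i).eq_or_lt with h0 | h0
  · rw [← h0]
    have := mul_nonneg (hq j) (Complex.normSq_nonneg y)
    simp; exact this
  · have hs : 0 < q j + t * p i := by have := hq j; positivity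
    rw [le_div_iff₀ hs]
    simp only [Complex.normSq_apply, Complex.mul_re, Complex.star_def, Complex.conj_re,
      Complex.conj_im]
    nlinarith [sq_nonneg (p i * w.re - (q j + t * p i) * y.re),
      sq_nonneg (p i * w.im - (q j + t * p i) * y.im)]

open Matrix in
lemma Qf_attained {m n l : Type*} [Fintype m] [Fintype n] [Fintype l]
    [DecidableEq m] [DecidableEq n] [DecidableEq l]
    (U : Matrix m n ℂ) (V : Matrix m l ℂ) (p : n → ℝ) (q : l → ℝ)
    (hU : Uᴴ * U = 1) (hV : Vᴴ * V = 1)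
    (hp : ∀ i, 0 ≤ p i) (hq : ∀ i, 0 ≤ q i) (t : ℝ) (ht : 0 < t) :
    ∃ X : Matrix m m ℂ,
    Qf (U * diagonal (fun i => (p i : ℂ)) * Uᴴ) (V * diagonal (fun i => (q i : ℂ)) * Vᴴ) X t =
    ∑ j, ∑ i, Complex.normSq ((Vᴴ * U) j i) * p i ^ 2 / (q j + t * p i) := by
  refine ⟨V * (Matrix.of fun j i => ((p i / (q j + t * p i) : ℝ) : ℂ) * (Vᴴ * U) j i) * Uᴴ, ?_⟩
  rw [Qf_eq U V p q hU hV]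
  refine Finset.sum_congr rfl fun j _ => Finset.sum_congr rfl fun i _ => ?_
  rw [Matrix.of_apply]
  generalize (Vᴴ * U) j i = w
  rcases (hp i).eq_or_lt with h0 | h0
  · rw [← h0]
    simp
  · have hs : 0 < q j + t * p i := by have := hq j; positivity
    generalize hS : q j + t * p i = s at *
    simp only [Complex.normSq_apply, Complex.mul_re, Complex.mul_im, Complex.star_def,
      Complex.conj_re, Complex.conj_im, Complex.ofReal_re, Complex.ofReal_im]
    field_simp
    ring

/-- partial trace over the second factor -/
def tr2 {μ γ : Type*} [Fintype γ] (M : Matrix (μ × γ) (μ × γ) ℂ) : Matrix μ μ ℂ :=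
  Matrix.of fun a b => ∑ c, M (a, c) (b, c)

open Matrix Kronecker in
lemma trace_mul_kron {μ γ : Type*} [Fintype μ] [Fintype γ] [DecidableEq γ]
    (A : Matrix (μ × γ) (μ × γ) ℂ) (Y : Matrix μ μ ℂ) :
    (A * (Y ⊗ₖ (1 : Matrix γ γ ℂ))).trace = (tr2 A * Y).trace := by
  simp only [trace, diag_apply, Matrix.mul_apply, Fintype.sum_prod_type, one_apply,
    kroneckerMap_apply, tr2, of_apply, mul_ite, mul_one, mul_zero, Finset.sum_ite_eq',
    Finset.mem_univ, if_true, Finset.sum_mul]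
  refine Finset.sum_congr rfl fun a _ => ?_
  rw [Finset.sum_comm]

open Matrix Kronecker in
lemma Qf_kron {μ γ : Type*} [Fintype μ] [Fintype γ] [DecidableEq γ]
    (ρ σ : Matrix (μ × γ) (μ × γ) ℂ) (Y : Matrix μ μ ℂ) (t : ℝ) :
    Qf ρ σ (Y ⊗ₖ (1 : Matrix γ γ ℂ)) t = Qf (tr2 ρ) (tr2 σ) Y t := by
  have hc : (Y ⊗ₖ (1 : Matrix γ γ ℂ))ᴴ = Yᴴ ⊗ₖ (1 : Matrix γ γ ℂ) := by
    rw [conjTranspose_kronecker, conjTranspose_one]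
  unfold Qf
  rw [hc]
  congr 3
  · congr 2
    rw [trace_mul_comm, trace_mul_kron, trace_mul_comm]
  · rw [Matrix.mul_assoc, trace_mul_comm, Matrix.mul_assoc, ← mul_kronecker_mul, Matrix.one_mul,
      trace_mul_kron, ← Matrix.mul_assoc, trace_mul_comm, Matrix.mul_assoc]
  · rw [Matrix.mul_assoc, trace_mul_comm, Matrix.mul_assoc, ← mul_kronecker_mul, Matrix.one_mul,
      trace_mul_kron, ← Matrix.mul_assoc, trace_mul_comm, Matrix.mul_assoc]

open Matrix in
lemma sum_normSq_col {l n : Type*} [Fintype l] [Fintype n] [DecidableEq n]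
    (W : Matrix l n ℂ) (hW : Wᴴ * W = 1) (i : n) : ∑ j, Complex.normSq (W j i) = 1 := by
  have h := congrFun (congrFun hW i) i
  rw [Matrix.mul_apply, one_apply_eq] at h
  have := congrArg Complex.re h
  rw [Complex.re_sum] at this
  simp only [conjTranspose_apply, Complex.one_re] at this
  rw [← this]
  refine Finset.sum_congr rfl fun j _ => ?_
  simp [Complex.normSq_apply]

open Matrix in
lemma sum_coef {m n l : Type*} [Fintype m] [Fintype n] [Fintype l]
    [DecidableEq m] [DecidableEq n] [DecidableEq l]
    (U : Matrix m n ℂ) (V : Matrix m l ℂ)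
    (hU : Uᴴ * U = 1) (hV' : V * Vᴴ = 1) (f : n → ℝ) :
    ∑ j, ∑ i, Complex.normSq ((Vᴴ * U) j i) * f i = ∑ i, f i := by
  rw [Finset.sum_comm]
  refine Finset.sum_congr rfl fun i _ => ?_
  rw [← Finset.sum_mul, sum_normSq_col, one_mul]
  rw [conjTranspose_mul, conjTranspose_conjTranspose, Matrix.mul_assoc, ← Matrix.mul_assoc V,
    hV', Matrix.one_mul, hU]

open Matrix in
lemma trace_spec {m n : Type*} [Fintype m] [Fintype n] [DecidableEq n]
    (U : Matrix m n ℂ) (p : n → ℝ) (hU : Uᴴ * U = 1) :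
    (U * diagonal (fun i => (p i : ℂ)) * Uᴴ).trace = ((∑ i, p i : ℝ) : ℂ) := by
  rw [trace_mul_comm, ← Matrix.mul_assoc, hU, Matrix.one_mul, trace_diagonal]
  push_cast; rfl

open Matrix in
theorem relent_mono {μ γ n l n' l' : Type*} [Fintype μ] [Fintype γ] [Fintype n] [Fintype l]
    [Fintype n'] [Fintype l']
    [DecidableEq μ] [DecidableEq γ] [DecidableEq n] [DecidableEq l] [DecidableEq n']
    [DecidableEq l']
    (U : Matrix (μ × γ) n ℂ) (V : Matrix (μ × γ) l ℂ) (p : n → ℝ) (q : l → ℝ)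
    (hU : Uᴴ * U = 1) (hV : Vᴴ * V = 1) (hU' : U * Uᴴ = 1) (hV' : V * Vᴴ = 1)
    (hp : ∀ i, 0 ≤ p i) (hq : ∀ i, 0 ≤ q i)
    (A : Matrix μ n' ℂ) (B : Matrix μ l' ℂ) (r : n' → ℝ) (s : l' → ℝ)
    (hA : Aᴴ * A = 1) (hB : Bᴴ * B = 1) (hB' : B * Bᴴ = 1)
    (hr : ∀ i, 0 ≤ r i) (hs : ∀ i, 0 ≤ s i)
    (h1 : tr2 (U * diagonal (fun i => (p i : ℂ)) * Uᴴ) = A * diagonal (fun i => (r i : ℂ)) * Aᴴ)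
    (h2 : tr2 (V * diagonal (fun i => (q i : ℂ)) * Vᴴ) = B * diagonal (fun i => (s i : ℂ)) * Bᴴ)
    (hsupp : ∀ j i, q j = 0 → Complex.normSq ((Vᴴ * U) j i) * p i = 0)
    (hsupp' : ∀ j i, s j = 0 → Complex.normSq ((Bᴴ * A) j i) * r i = 0) :
    ∑ j, ∑ i, Complex.normSq ((Vᴴ * U) j i) * p i * (Real.log (q j) - Real.log (p i)) ≤
    ∑ j, ∑ i, Complex.normSq ((Bᴴ * A) j i) * r i * (Real.log (s j) - Real.log (r i)) := by
  have key := log_compare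
    (fun k : l × n => Complex.normSq ((Vᴴ * U) k.1 k.2) * p k.2)
    (fun k : l × n => if Complex.normSq ((Vᴴ * U) k.1 k.2) * p k.2 = 0 then 1 else q k.1 / p k.2)
    (fun k : l' × n' => Complex.normSq ((Bᴴ * A) k.1 k.2) * r k.2)
    (fun k : l' × n' => if Complex.normSq ((Bᴴ * A) k.1 k.2) * r k.2 = 0 then 1
      else s k.1 / r k.2) ?_ ?_ ?_ ?_
  · simp only [Fintype.sum_prod_type] at key
    convert key using 3 with j _ i _ j _ i _
    · split_ifs with h
      · rw [h]; simp
      · rw [Real.log_div]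
        · exact fun h' => h (hsupp j i h')
        · exact fun h' => h (by rw [h', mul_zero])
    · split_ifs with h
      · rw [h]; simp
      · rw [Real.log_div]
        · exact fun h' => h (hsupp' j i h')
        · exact fun h' => h (by rw [h', mul_zero])
  · rintro ⟨j, i⟩
    dsimp only
    split_ifs with h
    · exact one_pos
    · exact div_pos ((hq j).lt_of_ne' fun h' => h (hsupp j i h'))
        ((hp i).lt_of_ne' fun h' => h (by rw [h', mul_zero]))
  · rintro ⟨j, i⟩
    dsimp only
    split_ifs with h
    · exact one_pos
    · exact div_pos ((hs j).lt_of_ne' fun h' => h (hsupp' j i h'))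
        ((hr i).lt_of_ne' fun h' => h (by rw [h', mul_zero]))
  · simp only [Fintype.sum_prod_type]
    rw [sum_coef U V hU hV', sum_coef A B hA hB']
    have e : (tr2 (U * diagonal (fun i => (p i : ℂ)) * Uᴴ)).trace
        = (U * diagonal (fun i => (p i : ℂ)) * Uᴴ).trace := by
      simp [trace, tr2, Fintype.sum_prod_type]
    rw [h1, trace_spec _ _ hA, trace_spec _ _ hU] at e
    exact_mod_cast e.symm
  · intro t ht
    obtain ⟨Y, hY⟩ := Qf_attained A B r s hA hB hr hs t ht
    have h3 := Qf_le U V p q hU hV hU' hV' hp hq (Matrix.kroneckerMap (· * ·) Y 1) t ht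
    rw [Qf_kron, h1, h2, hY] at h3
    simp only [Fintype.sum_prod_type]
    convert h3 using 3 with j _ i _ j _ i _
    · split_ifs with h
      · rw [h, sq, ← mul_assoc, h]; simp
      · have h0 : 0 < r i := (hr i).lt_of_ne' fun h' => h (by rw [h', mul_zero])
        have : 0 < s j + t * r i := by have := hs j; positivity
        field_simp
    · split_ifs with h
      · rw [h, sq, ← mul_assoc, h]; simp
      · have h0 : 0 < p i := (hp i).lt_of_ne' fun h' => h (by rw [h', mul_zero])
        have : 0 < q j + t * p i := by have := hq j; positivity
        field_simp

open Matrix in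
lemma vnEntropy_eq_roots {m : Type*} [Fintype m] [DecidableEq m] (ρ : Matrix m m ℂ)
    (h : ρ.IsHermitian) :
    vnEntropy ρ = -(ρ.charpoly.roots.map (fun z => z.re * Real.log z.re)).sum := by
  rw [vnEntropy, dif_pos h, h.roots_charpoly_eq_eigenvalues, Multiset.map_map]
  rfl

open Matrix in
lemma vnEntropy_submatrix {m n : Type*} [Fintype m] [DecidableEq m] [Fintype n] [DecidableEq n]
    (ρ : Matrix m m ℂ) (h : ρ.IsHermitian) (e : n ≃ m) :
    vnEntropy (ρ.submatrix e e) = vnEntropy ρ := by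
  rw [vnEntropy_eq_roots _ h, vnEntropy_eq_roots _ (h.submatrix e)]
  have := charpoly_reindex e.symm ρ
  rw [reindex_apply] at this
  simp only [Equiv.symm_symm] at this
  rw [this]

open Matrix in
lemma exists_spec {m : Type*} [Fintype m] [DecidableEq m] (ρ : Matrix m m ℂ)
    (h : ρ.PosSemidef) :
    ∃ (U : Matrix m m ℂ) (p : m → ℝ), Uᴴ * U = 1 ∧ U * Uᴴ = 1 ∧ (∀ i, 0 ≤ p i) ∧
      ρ = U * diagonal (fun i => (p i : ℂ)) * Uᴴ ∧
      vnEntropy ρ = -∑ i, p i * Real.log (p i) := by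
  refine ⟨h.isHermitian.eigenvectorUnitary, h.isHermitian.eigenvalues, ?_, ?_,
    h.eigenvalues_nonneg, ?_, ?_⟩
  · exact Unitary.coe_star_mul_self _
  · exact Unitary.coe_mul_star_self _
  · exact h.isHermitian.spectral_theorem
  · rw [vnEntropy, dif_pos h.isHermitian]

open Matrix in
lemma sum_row {m n l : Type*} [Fintype m] [Fintype n] [Fintype l] [DecidableEq n]
    (U : Matrix m n ℂ) (V : Matrix m l ℂ) (p : n → ℝ) (j : l) :
    ((∑ i, Complex.normSq ((Vᴴ * U) j i) * p i : ℝ) : ℂ) =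
      (Vᴴ * (U * diagonal (fun i => (p i : ℂ)) * Uᴴ) * V) j j := by
  have : Vᴴ * (U * diagonal (fun i => (p i : ℂ)) * Uᴴ) * V
      = (Vᴴ * U) * diagonal (fun i => (p i : ℂ)) * (Vᴴ * U)ᴴ := by
    rw [conjTranspose_mul, conjTranspose_conjTranspose]
    simp only [Matrix.mul_assoc]
  rw [this, Matrix.mul_apply]
  push_cast
  refine Finset.sum_congr rfl fun i _ => ?_
  rw [mul_diagonal, conjTranspose_apply, Complex.normSq_eq_conj_mul_self, Complex.star_def]
  ring

open Matrix Kronecker in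
lemma relent_val {m n α κ l : Type*} [Fintype m] [Fintype n] [Fintype α] [Fintype κ] [Fintype l]
    [DecidableEq m] [DecidableEq n] [DecidableEq α] [DecidableEq κ] [DecidableEq l]
    (e : m ≃ α × κ)
    (U : Matrix m n ℂ) (p : n → ℝ) (V : Matrix κ l ℂ) (q : l → ℝ)
    (hU : Uᴴ * U = 1) (hV : Vᴴ * V = 1) (hV' : V * Vᴴ = 1)
    (hp : ∀ i, 0 ≤ p i)
    (τ : Matrix κ κ ℂ) (hτ : τ = V * diagonal (fun i => (q i : ℂ)) * Vᴴ)
    (hτρ : ∀ x y, τ x y = ∑ a, (U * diagonal (fun i => (p i : ℂ)) * Uᴴ)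
      (e.symm (a, x)) (e.symm (a, y)))
    (W : Matrix m (α × l) ℂ)
    (hW : W = (((1 : Matrix α α ℂ) ⊗ₖ V).submatrix e id)) :
    Wᴴ * W = 1 ∧ W * Wᴴ = 1 ∧
    W * diagonal (fun j : α × l => (q j.2 : ℂ)) * Wᴴ
      = ((1 : Matrix α α ℂ) ⊗ₖ τ).submatrix e e ∧
    (∀ (j : α × l) i, q j.2 = 0 → Complex.normSq ((Wᴴ * U) j i) * p i = 0) ∧
    ∑ j : α × l, ∑ i, Complex.normSq ((Wᴴ * U) j i) * p i * (Real.log (q j.2) - Real.log (p i))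
      = ∑ j, q j * Real.log (q j) - ∑ i, p i * Real.log (p i) := by
  have hWc : Wᴴ = ((1 : Matrix α α ℂ) ⊗ₖ Vᴴ).submatrix id e := by
    rw [hW, conjTranspose_submatrix, conjTranspose_kronecker, conjTranspose_one]
  have h1 : Wᴴ * W = 1 := by
    rw [hWc, hW, submatrix_mul_equiv, ← mul_kronecker_mul, hV, Matrix.one_mul, one_kronecker_one,
      submatrix_id_id]
  have h2 : W * Wᴴ = 1 := by
    rw [hWc, hW, ← submatrix_mul _ _ _ id _ Function.bijective_id, ← mul_kronecker_mul, hV',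
      Matrix.one_mul, one_kronecker_one, submatrix_one_equiv]
  have h3 : W * diagonal (fun j : α × l => (q j.2 : ℂ)) * Wᴴ
      = ((1 : Matrix α α ℂ) ⊗ₖ τ).submatrix e e := by
    have hd : diagonal (fun j : α × l => (q j.2 : ℂ)) =
        ((1 : Matrix α α ℂ) ⊗ₖ diagonal (fun j => (q j : ℂ))).submatrix id id := by
      rw [← diagonal_one, diagonal_kronecker_diagonal, submatrix_id_id]
      simp
    rw [hd, hWc, hW, ← submatrix_mul _ _ _ id _ Function.bijective_id,
      ← submatrix_mul _ _ _ id _ Function.bijective_id, ← mul_kronecker_mul, ← mul_kronecker_mul,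
      Matrix.one_mul, Matrix.one_mul, hτ]
  -- diagonal sums
  have hrow : ∀ j : l, ∑ a : α, ∑ i, Complex.normSq ((Wᴴ * U) (a, j) i) * p i = q j := by
    intro j
    have hc : ((∑ a : α, ∑ i, Complex.normSq ((Wᴴ * U) (a, j) i) * p i : ℝ) : ℂ) = q j := by
      rw [Complex.ofReal_sum]
      simp only [sum_row U W p]
      generalize hρ : U * diagonal (fun i => (p i : ℂ)) * Uᴴ = ρ at *
      have hq : (Vᴴ * τ * V) j j = (q j : ℂ) := by
        have : Vᴴ * τ * V = (Vᴴ * V) * diagonal (fun i => (q i : ℂ)) * (Vᴴ * V) := by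
          rw [hτ]; simp only [Matrix.mul_assoc]
        rw [this, hV, Matrix.one_mul, Matrix.mul_one, diagonal_apply_eq]
      rw [← hq]
      have hWa : ∀ a, (Wᴴ * ρ * W) (a, j) (a, j) =
          ∑ y, ∑ x, star (V x j) * ρ (e.symm (a, x)) (e.symm (a, y)) * V y j := by
        intro a
        rw [Matrix.mul_apply, ← e.symm.sum_comp, Fintype.sum_prod_type]
        rw [Finset.sum_eq_single a]
        · refine Finset.sum_congr rfl fun y _ => ?_
          rw [Matrix.mul_apply, ← e.symm.sum_comp, Fintype.sum_prod_type]
          rw [Finset.sum_eq_single a]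
          · rw [Finset.sum_mul]
            refine Finset.sum_congr rfl fun x _ => ?_
            rw [hWc, hW]
            simp [kroneckerMap_apply]
          · intro b _ hb
            refine Finset.sum_eq_zero fun x _ => ?_
            rw [hWc]
            simp [kroneckerMap_apply, one_apply_ne hb.symm]
          · simp
        · intro b _ hb
          refine Finset.sum_eq_zero fun x _ => ?_
          rw [hW]
          simp [kroneckerMap_apply, one_apply_ne hb]
        · simp
      simp only [hWa]
      rw [Finset.sum_comm, Matrix.mul_apply]
      refine Finset.sum_congr rfl fun y _ => ?_
      rw [Finset.sum_comm, Matrix.mul_apply, Finset.sum_mul]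
      refine Finset.sum_congr rfl fun x _ => ?_
      rw [hτρ, Finset.mul_sum, Finset.sum_mul]
      rfl
    exact_mod_cast hc
  have hnn : ∀ j i, 0 ≤ Complex.normSq ((Wᴴ * U) j i) * p i :=
    fun j i => mul_nonneg (Complex.normSq_nonneg _) (hp i)
  refine ⟨h1, h2, h3, ?_, ?_⟩
  · rintro ⟨a, j⟩ i h0
    have hr := hrow j
    rw [show q j = 0 from h0] at hr
    have := (Finset.sum_eq_zero_iff_of_nonneg
      (fun a _ => Finset.sum_nonneg fun i _ => hnn (a, j) i)).1 hr a (Finset.mem_univ _)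
    exact (Finset.sum_eq_zero_iff_of_nonneg (fun i _ => hnn (a, j) i)).1 this i
      (Finset.mem_univ _)
  · simp only [mul_sub, Finset.sum_sub_distrib]
    congr 1
    · rw [Fintype.sum_prod_type, Finset.sum_comm]
      refine Finset.sum_congr rfl fun j _ => ?_
      simp only [← Finset.sum_mul]
      rw [hrow]
    · simp only [mul_assoc]
      exact sum_coef U W hU h2 (fun i => p i * Real.log (p i))

open Matrix in
lemma vnEntropy_ssa {α β γ : Type*} [Fintype α] [Fintype β] [Fintype γ]
    [DecidableEq α] [DecidableEq β] [DecidableEq γ]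
    (ρ : Matrix ((α × β) × γ) ((α × β) × γ) ℂ) (ρBC : Matrix (β × γ) (β × γ) ℂ)
    (ρAB : Matrix (α × β) (α × β) ℂ) (ρB : Matrix β β ℂ)
    (h : ρ.PosSemidef) (hBC : ρBC.PosSemidef) (hAB : ρAB.PosSemidef) (hB : ρB.PosSemidef)
    (h1 : ∀ x y, ρBC x y = ∑ a, ρ ((a, x.1), x.2) ((a, y.1), y.2))
    (h2 : ∀ x y, ρAB x y = ∑ c, ρ (x, c) (y, c))
    (h3 : ∀ x y, ρB x y = ∑ a, ρAB (a, x) (a, y)) :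
    vnEntropy ρ + vnEntropy ρB ≤ vnEntropy ρAB + vnEntropy ρBC := by
  obtain ⟨U, p, hU, hU', hp, hρ, e1⟩ := exists_spec ρ h
  obtain ⟨V, q, hV, hV', hq, hρBC, e2⟩ := exists_spec ρBC hBC
  obtain ⟨A, r, hA, hA', hr, hρAB, e3⟩ := exists_spec ρAB hAB
  obtain ⟨B, s, hB1, hB', hs, hρB, e4⟩ := exists_spec ρB hB
  obtain ⟨a1, a2, a3, a4, a5⟩ := relent_val (Equiv.prodAssoc α β γ) U p V q hU hV hV' hp ρBC hρBC
    (by intro x y; rw [← hρ, h1]; rfl) _ rfl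
  obtain ⟨b1, b2, b3, b4, b5⟩ := relent_val (Equiv.refl (α × β)) A r B s hA hB1 hB' hr ρB hρB
    (by intro x y; rw [← hρAB, h3]; rfl) _ rfl
  have key := relent_mono U _ p (fun j : α × (β × γ) => q j.2) hU a1 hU' a2 hp (fun i => hq _)
    A _ r (fun j : α × β => s j.2) hA b1 b2 hr (fun i => hs _)
    (by rw [← hρ, ← hρAB]; ext x y; rw [h2]; rfl)
    (by
      rw [a3, b3]
      ext ⟨a, b⟩ ⟨a', b'⟩
      simp only [tr2, of_apply, submatrix_apply, kroneckerMap_apply, Equiv.prodAssoc_apply,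
        Equiv.refl_apply]
      rw [h3]
      simp only [h1, h2]
      rw [Finset.sum_comm, Finset.mul_sum])
    a4 b4
  rw [a5, b5] at key
  linarith

/-- gluing of two partial functions with disjoint domains -/
def glueE {ι : Type*} {F : ι → Type*} (P Q R : ι → Prop) [DecidablePred P]
    (h : ∀ i, R i ↔ P i ∨ Q i) (hd : ∀ i, P i → ¬ Q i) :
    (((i : {j // P j}) → F i.1) × ((i : {j // Q j}) → F i.1)) ≃ ((i : {j // R j}) → F i.1) where
  toFun x i := if hp : P i.1 then x.1 ⟨i.1, hp⟩
    else x.2 ⟨i.1, ((h i.1).1 i.2).resolve_left hp⟩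
  invFun y := (fun i => y ⟨i.1, (h i.1).2 (Or.inl i.2)⟩, fun i => y ⟨i.1, (h i.1).2 (Or.inr i.2)⟩)
  left_inv := by
    rintro ⟨x, y⟩
    refine Prod.ext ?_ ?_
    · funext ⟨i, hi⟩
      simp [hi]
    · funext ⟨i, hi⟩
      have : ¬ P i := fun hp => hd i hp hi
      simp [this]
  right_inv := by
    intro y
    funext ⟨i, hi⟩
    by_cases hp : P i <;> simp [hp]

lemma glueE_left {ι : Type*} {F : ι → Type*} (P Q R : ι → Prop) [DecidablePred P]
    (h : ∀ i, R i ↔ P i ∨ Q i) (hd : ∀ i, P i → ¬ Q i)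
    (x : (i : {j // P j}) → F i.1) (y : (i : {j // Q j}) → F i.1) (i : ι) (hi : R i) (hp : P i) :
    glueE P Q R h hd (x, y) ⟨i, hi⟩ = x ⟨i, hp⟩ := by
  simp [glueE, hp]

lemma glueE_right {ι : Type*} {F : ι → Type*} (P Q R : ι → Prop) [DecidablePred P]
    (h : ∀ i, R i ↔ P i ∨ Q i) (hd : ∀ i, P i → ¬ Q i)
    (x : (i : {j // P j}) → F i.1) (y : (i : {j // Q j}) → F i.1) (i : ι) (hi : R i) (hq : Q i) :
    glueE P Q R h hd (x, y) ⟨i, hi⟩ = y ⟨i, hq⟩ := by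
  have hp : ¬ P i := fun hp => hd i hp hq
  simp [glueE, hp]

section marg

variable {ι : Type*} [Fintype ι] [DecidableEq ι] {dim : ι → ℕ}
  (ψ : Matrix ((i : ι) → Fin (dim i)) ((i : ι) → Fin (dim i)) ℂ)

lemma marginal_split (S T R : Finset ι) (h : ∀ i, i ∈ R ↔ i ∈ S ∨ i ∈ T)
    (hd : ∀ i, i ∈ S → ¬ i ∈ T) (x y : (i : {j : ι // j ∈ S}) → Fin (dim i.1)) :
    marginal ψ S x y = ∑ t : (i : {j : ι // j ∈ T}) → Fin (dim i.1),
      marginal ψ R (glueE (F := fun i => Fin (dim i)) (· ∈ S) (· ∈ T) (· ∈ R) h hd (x, t))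
        (glueE (F := fun i => Fin (dim i)) (· ∈ S) (· ∈ T) (· ∈ R) h hd (y, t)) := by
  have h' : ∀ i, i ∉ S ↔ i ∈ T ∨ i ∉ R := by
    intro i; have := h i; have := hd i; tauto
  have hd' : ∀ i, i ∈ T → ¬ i ∉ R := by
    intro i; have := h i; tauto
  unfold marginal
  rw [← (glueE (F := fun i => Fin (dim i)) (· ∈ T) (· ∉ R) (· ∉ S) h' hd').sum_comp,
    Fintype.sum_prod_type]
  refine Finset.sum_congr rfl fun t _ => Finset.sum_congr rfl fun z _ => ?_
  have key : ∀ x : (i : {j : ι // j ∈ S}) → Fin (dim i.1),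
    (fun i => if h : i ∈ S then x ⟨i, h⟩ else
      (glueE (F := fun i => Fin (dim i)) (· ∈ T) (· ∉ R) (· ∉ S) h' hd') (t, z) ⟨i, h⟩ :
      (i : ι) → Fin (dim i)) =
    (fun i => if hi : i ∈ R then
      (glueE (F := fun i => Fin (dim i)) (· ∈ S) (· ∈ T) (· ∈ R) h hd) (x, t) ⟨i, hi⟩
      else z ⟨i, hi⟩ : (i : ι) → Fin (dim i)) := by
    intro x
    funext i
    have := h i
    have := hd i
    by_cases h1 : i ∈ S <;> by_cases h2 : i ∈ T <;> by_cases h3 : i ∈ R <;>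
      simp [glueE, h1, h2, h3] <;> tauto
  rw [key x, key y]

lemma marginal_posSemidef (hψ : ψ.PosSemidef) (S : Finset ι) : (marginal ψ S).PosSemidef := by
  have : marginal ψ S = ∑ z : (i : {j : ι // j ∉ S}) → Fin (dim i.1),
      ψ.submatrix (fun x i => if h : i ∈ S then x ⟨i, h⟩ else z ⟨i, h⟩)
        (fun x i => if h : i ∈ S then x ⟨i, h⟩ else z ⟨i, h⟩) := by
    ext x y
    rw [Matrix.sum_apply]
    rfl
  rw [this]
  exact Matrix.posSemidef_sum _ fun z _ => hψ.submatrix _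

lemma marginal_trace (S : Finset ι) : (marginal ψ S).trace = ψ.trace := by
  have e := (Equiv.piEquivPiSubtypeProd (· ∈ S) (fun i => Fin (dim i))).symm.sum_comp
    (fun x => ψ x x)
  rw [Fintype.sum_prod_type] at e
  exact e

lemma mEnt_ssa (hψ : ψ.PosSemidef) (A B C AB BC ABC : Finset ι)
    (hAB : ∀ i, i ∈ AB ↔ i ∈ A ∨ i ∈ B) (hBC : ∀ i, i ∈ BC ↔ i ∈ B ∨ i ∈ C)
    (hABC : ∀ i, i ∈ ABC ↔ i ∈ AB ∨ i ∈ C)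
    (dAB : ∀ i, i ∈ A → ¬ i ∈ B) (dBC : ∀ i, i ∈ B → ¬ i ∈ C) (dAC : ∀ i, i ∈ A → ¬ i ∈ C) :
    mEnt ψ ABC + mEnt ψ B ≤ mEnt ψ AB + mEnt ψ BC := by
  have dABC : ∀ i, i ∈ AB → ¬ i ∈ C := by
    intro i hi; rcases (hAB i).1 hi with h | h
    · exact dAC i h
    · exact dBC i h
  have hABC' : ∀ i, i ∈ ABC ↔ i ∈ BC ∨ i ∈ A := by
    intro i; rw [hABC, hAB, hBC]; tauto
  have dBCA : ∀ i, i ∈ BC → ¬ i ∈ A := by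
    intro i hi h; rcases (hBC i).1 hi with h' | h'
    · exact dAB i h h'
    · exact dAC i h h'
  let eAB := glueE (F := fun i => Fin (dim i)) (· ∈ A) (· ∈ B) (· ∈ AB) hAB dAB
  let eBC := glueE (F := fun i => Fin (dim i)) (· ∈ B) (· ∈ C) (· ∈ BC) hBC dBC
  let eABC := glueE (F := fun i => Fin (dim i)) (· ∈ AB) (· ∈ C) (· ∈ ABC) hABC dABC
  let e := (Equiv.prodCongr eAB (Equiv.refl _)).trans eABC
  have p1 := marginal_posSemidef ψ hψ ABC
  have p2 := marginal_posSemidef ψ hψ AB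
  have p3 := marginal_posSemidef ψ hψ BC
  have p4 := marginal_posSemidef ψ hψ B
  unfold mEnt
  rw [← vnEntropy_submatrix _ p1.isHermitian e, ← vnEntropy_submatrix _ p2.isHermitian eAB,
    ← vnEntropy_submatrix _ p3.isHermitian eBC]
  refine vnEntropy_ssa _ _ _ _ (p1.submatrix e) (p3.submatrix eBC) (p2.submatrix eAB) p4 ?_ ?_ ?_
  · intro x y
    have key : ∀ (x : ((i : {j // j ∈ B}) → Fin (dim i.1)) × ((i : {j // j ∈ C}) → Fin (dim i.1)))
        (a : (i : {j // j ∈ A}) → Fin (dim i.1)),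
        glueE (F := fun i => Fin (dim i)) (· ∈ BC) (· ∈ A) (· ∈ ABC) hABC' dBCA (eBC x, a)
        = e ((a, x.1), x.2) := by
      rintro ⟨b, c⟩ a
      funext ⟨i, hi⟩
      change _ = eABC (eAB (a, b), c) ⟨i, hi⟩
      rcases (hABC i).1 hi with hab | hc
      · rcases (hAB i).1 hab with ha | hb
        · rw [glueE_right _ _ _ _ _ _ _ _ _ ha, glueE_left _ _ _ _ _ _ _ _ _ hab,
            glueE_left _ _ _ _ _ _ _ _ _ ha]
        · have hbc := (hBC i).2 (Or.inl hb)
          rw [glueE_left _ _ _ _ _ _ _ _ _ hbc, glueE_left _ _ _ _ _ _ _ _ _ hb,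
            glueE_left _ _ _ _ _ _ _ _ _ hab, glueE_right _ _ _ _ _ _ _ _ _ hb]
      · have hbc := (hBC i).2 (Or.inr hc)
        rw [glueE_left _ _ _ _ _ _ _ _ _ hbc, glueE_right _ _ _ _ _ _ _ _ _ hc,
          glueE_right _ _ _ _ _ _ _ _ _ hc]
    rw [Matrix.submatrix_apply, marginal_split ψ BC A ABC hABC' dBCA]
    refine Finset.sum_congr rfl fun a _ => ?_
    rw [key, key]
    rfl
  · intro x y
    rw [Matrix.submatrix_apply, marginal_split ψ AB C ABC hABC dABC]
    rfl
  · intro x y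
    have hBA : ∀ i, i ∈ AB ↔ i ∈ B ∨ i ∈ A := by intro i; rw [hAB]; tauto
    have dBA : ∀ i, i ∈ B → ¬ i ∈ A := fun i h h' => dAB i h' h
    have key : ∀ (x : ((i : {j // j ∈ B}) → Fin (dim i.1)))
        (a : (i : {j // j ∈ A}) → Fin (dim i.1)),
        glueE (F := fun i => Fin (dim i)) (· ∈ B) (· ∈ A) (· ∈ AB) hBA dBA (x, a)
        = eAB (a, x) := by
      intro x a
      funext ⟨i, hi⟩
      have := hAB i
      have := dAB i
      by_cases h1 : i ∈ A <;> by_cases h2 : i ∈ B <;>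
        simp [eAB, glueE, h1, h2] <;> tauto
    rw [marginal_split ψ B A AB hBA dBA]
    refine Finset.sum_congr rfl fun a _ => ?_
    rw [key, key]
    rfl

end marg

open Matrix in
lemma vnEntropy_bounds {m : Type*} [Fintype m] [DecidableEq m] (ρ : Matrix m m ℂ)
    (h : ρ.PosSemidef) (htr : ρ.trace = 1) :
    0 ≤ vnEntropy ρ ∧ vnEntropy ρ ≤ Real.log (Fintype.card m) := by
  obtain ⟨U, p, hU, hU', hp, hρ, e⟩ := exists_spec ρ h
  have hsum : ∑ i, p i = 1 := by
    have := trace_spec U p hU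
    rw [← hρ, htr] at this
    exact_mod_cast this.symm
  have hle : ∀ i, p i ≤ 1 := fun i =>
    hsum ▸ Finset.single_le_sum (fun i _ => hp i) (Finset.mem_univ i)
  have hne : Nonempty m := by
    by_contra hne
    rw [not_nonempty_iff] at hne
    simp at hsum
  have hN : (0 : ℝ) < Fintype.card m := by exact_mod_cast Fintype.card_pos
  rw [e]
  constructor
  · rw [← Finset.sum_neg_distrib]
    refine Finset.sum_nonneg fun i _ => ?_
    have := Real.log_nonpos (hp i) (hle i)
    nlinarith [hp i]
  · have key : ∀ i, -(p i * Real.log (p i)) ≤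
        p i * Real.log (Fintype.card m) + ((Fintype.card m : ℝ)⁻¹ - p i) := by
      intro i
      rcases (hp i).eq_or_lt with h0 | h0
      · rw [← h0]; simp
      · have h1 := Real.log_le_sub_one_of_pos (x := (p i * Fintype.card m)⁻¹) (by positivity)
        rw [Real.log_inv, Real.log_mul h0.ne' hN.ne'] at h1
        have h2 := mul_le_mul_of_nonneg_left h1 h0.le
        have h3 : p i * ((p i * Fintype.card m)⁻¹ - 1) = (Fintype.card m : ℝ)⁻¹ - p i := by
          field_simp
        rw [h3] at h2
        linarith
    rw [← Finset.sum_neg_distrib]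
    refine (Finset.sum_le_sum fun i _ => key i).trans ?_
    rw [Finset.sum_add_distrib, Finset.sum_sub_distrib, ← Finset.sum_mul, hsum]
    simp [hN.ne']

open Matrix in
lemma vnEntropy_maxmix {m : Type*} [Fintype m] [DecidableEq m] (K : ℕ) (hK : 1 ≤ K)
    (hc : Fintype.card m = K) : vnEntropy ((K : ℂ)⁻¹ • (1 : Matrix m m ℂ)) = Real.log K := by
  have hd : (K : ℂ)⁻¹ • (1 : Matrix m m ℂ) = diagonal (fun _ => ((K⁻¹ : ℝ) : ℂ)) := by
    rw [smul_one_eq_diagonal]; simp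
  have hK' : (K : ℝ) ≠ 0 := by positivity
  rw [hd, vnEntropy_eq_roots]
  · rw [charpoly_diagonal, Finset.prod_const, Polynomial.roots_pow, Polynomial.roots_X_sub_C,
      Finset.card_univ, hc, Multiset.map_nsmul, Multiset.sum_nsmul]
    simp only [Multiset.map_singleton, Multiset.sum_singleton, Complex.ofReal_re, Real.log_inv]
    simp [hK']
  · rw [IsHermitian, diagonal_conjTranspose]
    congr 1
    funext i
    simp

section han

variable {n : ℕ} (f : Finset (Fin n) → ℝ)

lemma leave_one_out (h0 : 0 ≤ f ∅)
    (hsub : ∀ (T : Finset (Fin n)) a i, i ∈ T → a ∉ T →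
      f (insert a T) + f (T.erase i) ≤ f (insert a (T.erase i)) + f T) (T : Finset (Fin n)) :
    ∑ i ∈ T, (f T - f (T.erase i)) ≤ f T := by
  induction T using Finset.induction_on with
  | empty => simpa using h0
  | insert a T ha ih =>
    rw [Finset.sum_insert ha, Finset.erase_insert ha]
    have : ∑ i ∈ T, (f (insert a T) - f ((insert a T).erase i)) ≤
        ∑ i ∈ T, (f T - f (T.erase i)) := by
      refine Finset.sum_le_sum fun i hi => ?_
      have hne : a ≠ i := fun h => ha (h ▸ hi)
      rw [Finset.erase_insert_of_ne hne]
      have := hsub T a i hi ha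
      linarith
    linarith

lemma double_count (k : ℕ) :
    ∑ T ∈ Finset.powersetCard (k + 1) (Finset.univ : Finset (Fin n)), ∑ i ∈ T, f (T.erase i)
      = ((n : ℝ) - k) * ∑ S ∈ Finset.powersetCard k (Finset.univ : Finset (Fin n)), f S := by
  have h1 : ((n : ℝ) - k) * ∑ S ∈ Finset.powersetCard k (Finset.univ : Finset (Fin n)), f S
      = ∑ S ∈ Finset.powersetCard k (Finset.univ : Finset (Fin n)), ∑ i ∈ Sᶜ, f S := by
    rw [Finset.mul_sum]
    refine Finset.sum_congr rfl fun S hS => ?_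
    have hc := (Finset.mem_powersetCard.1 hS).2
    have hle : S.card ≤ n := by simpa using Finset.card_le_univ S
    rw [Finset.sum_const, Finset.card_compl, Fintype.card_fin, nsmul_eq_mul, Nat.cast_sub hle, hc]
  rw [h1, Finset.sum_sigma', Finset.sum_sigma']
  refine Finset.sum_bij' (fun x _ => ⟨x.1.erase x.2, x.2⟩) (fun x _ => ⟨insert x.2 x.1, x.2⟩)
    ?_ ?_ ?_ ?_ ?_
  · rintro ⟨T, i⟩ h
    simp only [Finset.mem_sigma, Finset.mem_powersetCard, Finset.subset_univ, true_and] at h ⊢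
    refine ⟨?_, by simp⟩
    rw [Finset.card_erase_of_mem h.2, h.1]; rfl
  · rintro ⟨T, i⟩ h
    simp only [Finset.mem_sigma, Finset.mem_powersetCard, Finset.subset_univ, true_and,
      Finset.mem_compl] at h ⊢
    refine ⟨?_, by simp⟩
    rw [Finset.card_insert_of_notMem h.2, h.1]
  · rintro ⟨T, i⟩ h
    simp only [Finset.mem_sigma] at h
    simp [Finset.insert_erase h.2]
  · rintro ⟨T, i⟩ h
    simp only [Finset.mem_sigma, Finset.mem_compl] at h
    simp [Finset.erase_insert h.2]
  · rintro ⟨T, i⟩ h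
    rfl

lemma han_step (h0 : 0 ≤ f ∅)
    (hsub : ∀ (T : Finset (Fin n)) a i, i ∈ T → a ∉ T →
      f (insert a T) + f (T.erase i) ≤ f (insert a (T.erase i)) + f T) (k : ℕ) :
    (k : ℝ) * ∑ S ∈ Finset.powersetCard (k + 1) (Finset.univ : Finset (Fin n)), f S ≤
      ((n : ℝ) - k) * ∑ S ∈ Finset.powersetCard k (Finset.univ : Finset (Fin n)), f S := by
  rw [← double_count, Finset.mul_sum]
  refine Finset.sum_le_sum fun T hT => ?_
  have h := leave_one_out f h0 hsub T
  rw [Finset.sum_sub_distrib, Finset.sum_const, (Finset.mem_powersetCard.1 hT).2,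
    nsmul_eq_mul] at h
  push_cast at h
  linarith

lemma han (h0 : 0 ≤ f ∅)
    (hsub : ∀ (T : Finset (Fin n)) a i, i ∈ T → a ∉ T →
      f (insert a T) + f (T.erase i) ≤ f (insert a (T.erase i)) + f T)
    (a b : ℕ) (ha : 1 ≤ a) (hab : a ≤ b) (hb : b ≤ n) :
    (∑ S ∈ Finset.powersetCard b (Finset.univ : Finset (Fin n)), f S) / (n.choose b : ℝ) / b ≤
    (∑ S ∈ Finset.powersetCard a (Finset.univ : Finset (Fin n)), f S) / (n.choose a : ℝ) / a := by
  induction b, hab using Nat.le_induction with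
  | base => exact le_rfl
  | succ k hk ih =>
    refine le_trans ?_ (ih (by omega))
    have hs := han_step f h0 hsub k
    generalize (∑ S ∈ Finset.powersetCard (k + 1) (Finset.univ : Finset (Fin n)), f S) = x at *
    generalize (∑ S ∈ Finset.powersetCard k (Finset.univ : Finset (Fin n)), f S) = y at *
    have hc := Nat.choose_succ_right_eq n k
    have hc' : (n.choose (k + 1) : ℝ) * (k + 1) = n.choose k * ((n : ℝ) - k) := by
      rw [← Nat.cast_sub (by omega)]
      exact_mod_cast hc
    have p1 : (0 : ℝ) < n.choose k := by exact_mod_cast Nat.choose_pos (by omega)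
    have p2 : (0 : ℝ) < n.choose (k + 1) := by exact_mod_cast Nat.choose_pos (by omega)
    have p3 : (0 : ℝ) < k := by exact_mod_cast (by omega : 0 < k)
    push_cast
    rw [div_div, div_div, hc', div_le_div_iff₀ (by rw [← hc']; positivity) (by positivity)]
    nlinarith

end han

/-- entropic quantum Singleton bound. `R = Sum.inr ()`. -/
theorem entropic_quantum_singleton
    (n d K q : ℕ) (hq : 2 ≤ q) (hK : 1 ≤ K) (hd : 2 ≤ d) (hdn : 2 * (d - 1) < n)
    (dim : Fin n ⊕ Unit → ℕ)
    (hdimX : ∀ i : Fin n, dim (Sum.inl i) = q)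
    (hdimR : dim (Sum.inr ()) = K)
    (ψ : Matrix ((i : Fin n ⊕ Unit) → Fin (dim i))
                ((i : Fin n ⊕ Unit) → Fin (dim i)) ℂ)
    (hpsd : ψ.PosSemidef) (htr : ψ.trace = 1) (hpure : ψ.rank = 1)
    (hmaxmix : marginal ψ ({Sum.inr ()} : Finset (Fin n ⊕ Unit)) = (K : ℂ)⁻¹ • 1)
    (hdec : ∀ I J : Finset (Fin n), Disjoint I J → I ∪ J = Finset.univ →
      I.card = n - d + 1 → J.card = d - 1 →
      mEnt ψ (I.image Sum.inl) =
        mEnt ψ ({Sum.inr ()} : Finset (Fin n ⊕ Unit)) + mEnt ψ (J.image Sum.inl)) :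
    Real.log K ≤ ((n : ℝ) - 2 * d + 2) *
        ((1 / ((d : ℝ) - 1)) *
          ((∑ J ∈ Finset.powersetCard (d - 1) (Finset.univ : Finset (Fin n)),
            mEnt ψ (J.image Sum.inl)) / (n.choose (d - 1) : ℝ)))
    ∧ ((n : ℝ) - 2 * d + 2) *
        ((1 / ((d : ℝ) - 1)) *
          ((∑ J ∈ Finset.powersetCard (d - 1) (Finset.univ : Finset (Fin n)),
            mEnt ψ (J.image Sum.inl)) / (n.choose (d - 1) : ℝ)))
      ≤ ((n : ℝ) - 2 * d + 2) * Real.log q := by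

  classical
  set f : Finset (Fin n) → ℝ := fun I => mEnt ψ (I.image Sum.inl) with hf
  have hb : ∀ I : Finset (Fin n), 0 ≤ f I ∧ f I ≤ I.card * Real.log q := by
    intro I
    have h := vnEntropy_bounds _ (marginal_posSemidef ψ hpsd (I.image Sum.inl))
      (by rw [marginal_trace, htr])
    refine ⟨h.1, h.2.trans (le_of_eq ?_)⟩
    have hcard : Nat.card ((i : {j : Fin n ⊕ Unit // j ∈ I.image Sum.inl}) → Fin (dim i.1))
        = q ^ I.card := by
      rw [Nat.card_pi]
      have : ∀ i : {j : Fin n ⊕ Unit // j ∈ I.image Sum.inl},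
          Nat.card (Fin (dim i.1)) = q := by
        rintro ⟨i, hi⟩
        obtain ⟨j, _, rfl⟩ := Finset.mem_image.1 hi
        simp [hdimX]
      simp only [this, Finset.prod_const, Finset.card_univ]
      rw [Fintype.card_of_subtype (I.image Sum.inl) (fun _ => Iff.rfl),
        Finset.card_image_of_injective _ Sum.inl_injective]
    rw [← Nat.card_eq_fintype_card, hcard]
    push_cast
    rw [Real.log_pow]
  have hsub : ∀ (T : Finset (Fin n)) a i, i ∈ T → a ∉ T →
      f (insert a T) + f (T.erase i) ≤ f (insert a (T.erase i)) + f T := by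
    intro T a i hi ha
    have hne : a ≠ i := fun h => ha (h ▸ hi)
    refine mEnt_ssa ψ hpsd (({a} : Finset (Fin n)).image Sum.inl) ((T.erase i).image Sum.inl)
      (({i} : Finset (Fin n)).image Sum.inl) _ _ _ ?_ ?_ ?_ ?_ ?_ ?_
    all_goals
      rintro (j | j)
      · simp only [Finset.mem_image, Sum.inl.injEq, exists_eq_right, Finset.mem_insert,
          Finset.mem_erase, Finset.mem_singleton]
        try (by_cases h1 : j = a <;> by_cases h2 : j = i <;> simp_all)
      · simp_all
  have hR : mEnt ψ ({Sum.inr ()} : Finset (Fin n ⊕ Unit)) = Real.log K := by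
    unfold mEnt
    rw [hmaxmix]
    apply vnEntropy_maxmix K hK
    rw [Fintype.card_pi]
    have : ∀ i : {j : Fin n ⊕ Unit // j ∈ ({Sum.inr ()} : Finset (Fin n ⊕ Unit))},
          Fintype.card (Fin (dim i.1)) = K := by
      rintro ⟨i, hi⟩
      rw [Finset.mem_singleton] at hi
      subst hi
      simp [hdimR]
    simp only [this, Finset.prod_const, Finset.card_univ, Fintype.card_coe]
    simp
  obtain ⟨m, rfl⟩ : ∃ m, d = m + 1 := ⟨d - 1, by omega⟩
  simp only [Nat.add_sub_cancel] at *
  have hm : 1 ≤ m := by omega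
  have hsum : ∑ S ∈ Finset.powersetCard (n - m) (Finset.univ : Finset (Fin n)), f S =
      (n.choose m : ℝ) * Real.log K
        + ∑ J ∈ Finset.powersetCard m (Finset.univ : Finset (Fin n)), f J := by
    have h1 : ∑ S ∈ Finset.powersetCard (n - m) (Finset.univ : Finset (Fin n)), f S =
        ∑ J ∈ Finset.powersetCard m (Finset.univ : Finset (Fin n)), f Jᶜ := by
      refine Finset.sum_bij' (fun S _ => Sᶜ) (fun S _ => Sᶜ) ?_ ?_ ?_ ?_ ?_
      · intro S hS
        simp only [Finset.mem_powersetCard, Finset.subset_univ, true_and] at hS ⊢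
        rw [Finset.card_compl, hS, Fintype.card_fin]; omega
      · intro S hS
        simp only [Finset.mem_powersetCard, Finset.subset_univ, true_and] at hS ⊢
        rw [Finset.card_compl, hS, Fintype.card_fin]
      · intro S _; simp
      · intro S _; simp
      · intro S _; simp
    rw [h1]
    have h2 : ∀ J ∈ Finset.powersetCard m (Finset.univ : Finset (Fin n)),
        f Jᶜ = Real.log K + f J := by
      intro J hJ
      have hJc := (Finset.mem_powersetCard.1 hJ).2
      rw [← hR]
      refine hdec Jᶜ J disjoint_compl_left (by rw [Finset.union_comm]; exact Finset.union_compl J) ?_ hJc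
      rw [Finset.card_compl, Fintype.card_fin, hJc]; omega
    rw [Finset.sum_congr rfl h2, Finset.sum_add_distrib, Finset.sum_const,
      Finset.card_powersetCard, Finset.card_univ, Fintype.card_fin, nsmul_eq_mul]
  have hhan := han f (hb ∅).1 hsub m (n - m) hm (by omega) (by omega)
  rw [hsum, Nat.choose_symm (by omega), Nat.cast_sub (by omega)] at hhan
  have hup : ∑ J ∈ Finset.powersetCard m (Finset.univ : Finset (Fin n)), f J ≤
      (n.choose m : ℝ) * (m * Real.log q) := by
    have : ∑ J ∈ Finset.powersetCard m (Finset.univ : Finset (Fin n)), f J ≤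
      ∑ J ∈ Finset.powersetCard m (Finset.univ : Finset (Fin n)), (m * Real.log q) := by
      refine Finset.sum_le_sum fun J hJ => ?_
      have := (hb J).2
      rwa [(Finset.mem_powersetCard.1 hJ).2] at this
    rwa [Finset.sum_const, Finset.card_powersetCard, Finset.card_univ, Fintype.card_fin,
      nsmul_eq_mul] at this
  generalize (∑ J ∈ Finset.powersetCard m (Finset.univ : Finset (Fin n)), f J) = s at *
  have hC : (0 : ℝ) < n.choose m := by exact_mod_cast Nat.choose_pos (by omega)
  have hm' : (0 : ℝ) < m := by exact_mod_cast hm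
  have hn' : (2 : ℝ) * m < n := by exact_mod_cast hdn
  generalize (n.choose m : ℝ) = c at *
  push_cast
  rw [show (m : ℝ) + 1 - 1 = m by ring, show (n : ℝ) - 2 * (m + 1) + 2 = n - 2 * m by ring]
  constructor
  · rw [add_div, mul_div_cancel_left₀ _ hC.ne', div_le_div_iff₀ (by linarith) hm'] at hhan
    generalize s / c = σ at *
    rw [one_div, ← mul_assoc, mul_comm _ (m : ℝ)⁻¹, mul_assoc, ← div_eq_inv_mul, le_div_iff₀ hm']
    linarith
  · refine mul_le_mul_of_nonneg_left ?_ (by linarith)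
    rw [one_div, ← div_eq_inv_mul, div_div, div_le_iff₀ (by positivity)]
    linarith
end

section
/- Every QMDS code is pure (entropic form). Let n, d, K, q be integers with q ≥ 2, K ≥ 2, d ≥ 2, and 2(d−1) < n. Let ψ be a pure quantum state on R ⊗ X_1 ⊗ … ⊗ X_n, where R has dimension K and each X_i has dimension q, whose marginal on R is the maximally mixed state (1/K)·Id_K. Suppose that for every partition {1,…,n} = I ∪ J with |I| = n−d+1 and |J| = d−1, S(X_I)_ψ = S(R)_ψ + S(X_J)_ψ, and suppose moreover that log K = (n−2d+2)·log q. Then for every subset J ⊆ {1,…,n} with |J| = d−1, the marginal of ψ on X_J is the maximally mixed state q^{−(d−1)}·Id. -/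
open scoped BigOperators ComplexOrder

section
open scoped Matrix

/-- Scalar form of Klein's inequality. -/
theorem klein_scalar {m j : Type*} [Fintype m] [Fintype j] (p : m → ℝ) (s : j → ℝ)
    (P : m → j → ℝ) (hp : ∀ i, 0 ≤ p i) (hs : ∀ k, 0 ≤ s k) (hP : ∀ i k, 0 ≤ P i k)
    (hrow : ∀ i, ∑ k, P i k = 1) (hcol : ∀ k, ∑ i, P i k = 1)
    (hps : ∑ i, p i = ∑ k, s k) (hker : ∀ i k, s k = 0 → p i * P i k = 0) :
    (-∑ i, p i * Real.log (p i) ≤ -∑ k, (∑ i, p i * P i k) * Real.log (s k)) ∧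
    (-∑ i, p i * Real.log (p i) = -∑ k, (∑ i, p i * P i k) * Real.log (s k) →
      ∀ i k, P i k ≠ 0 → p i = s k) := by
  have key : ∀ x y : ℝ, 0 ≤ x → 0 < y → 0 ≤ x * Real.log x - x * Real.log y - (x - y) ∧
      (x * Real.log x - x * Real.log y - (x - y) = 0 → x = y) := by
    intro x y hx hy
    rcases hx.eq_or_lt with rfl | hx
    · simp; exact ⟨hy.le, fun h => h.symm⟩
    · have h1 : Real.log (y / x) = Real.log y - Real.log x := Real.log_div hy.ne' hx.ne'
      have h2 : x * (y / x) = y := by field_simp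
      refine ⟨?_, ?_⟩
      · have := Real.log_le_sub_one_of_pos (div_pos hy hx)
        nlinarith
      · intro h
        by_contra hne
        have hne' : y / x ≠ 1 := by
          intro h'; rw [div_eq_one_iff_eq hx.ne'] at h'; exact hne h'.symm
        have := Real.log_lt_sub_one_of_pos (div_pos hy hx) hne'
        nlinarith
  have hnn : ∀ i k, 0 ≤ P i k * (p i * Real.log (p i) - p i * Real.log (s k) - (p i - s k)) := by
    intro i k
    rcases (hs k).eq_or_lt with h | h
    · have := hker i k h.symm
      have h2 : P i k * (p i * Real.log (p i) - p i * Real.log (s k) - (p i - s k))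
        = (p i * P i k) * (Real.log (p i) - Real.log (s k) - 1) + P i k * s k := by ring
      rw [h2, this, ← h]; simp
    · exact mul_nonneg (hP i k) (key _ _ (hp i) h).1
  have hsum : ∑ i, ∑ k, P i k * (p i * Real.log (p i) - p i * Real.log (s k) - (p i - s k))
      = ∑ i, p i * Real.log (p i) - ∑ k, (∑ i, p i * P i k) * Real.log (s k) := by
    have e1 : ∑ i, ∑ k, P i k * (p i * Real.log (p i)) = ∑ i, p i * Real.log (p i) := by
      refine Finset.sum_congr rfl fun i _ => ?_
      rw [← Finset.sum_mul, hrow, one_mul]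
    have e2 : ∑ i, ∑ k, P i k * (p i * Real.log (s k))
        = ∑ k, (∑ i, p i * P i k) * Real.log (s k) := by
      rw [Finset.sum_comm]
      refine Finset.sum_congr rfl fun k _ => ?_
      rw [Finset.sum_mul]
      exact Finset.sum_congr rfl fun i _ => by ring
    have e3 : ∑ i, ∑ k, P i k * p i = ∑ i, p i := by
      refine Finset.sum_congr rfl fun i _ => ?_
      rw [← Finset.sum_mul, hrow, one_mul]
    have e4 : ∑ i, ∑ k, P i k * s k = ∑ k, s k := by
      rw [Finset.sum_comm]
      refine Finset.sum_congr rfl fun k _ => ?_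
      rw [← Finset.sum_mul, hcol, one_mul]
    simp only [mul_sub, Finset.sum_sub_distrib]
    rw [e1, e2, e3, e4]; linarith
  refine ⟨?_, ?_⟩
  · have := Finset.sum_nonneg fun i (_ : i ∈ Finset.univ) =>
      Finset.sum_nonneg fun k (_ : k ∈ Finset.univ) => hnn i k
    linarith
  · intro h i k hik
    have h0 : ∑ i, ∑ k, P i k * (p i * Real.log (p i) - p i * Real.log (s k) - (p i - s k)) = 0 := by
      rw [hsum]; linarith
    rw [Finset.sum_eq_zero_iff_of_nonneg
      (fun i _ => Finset.sum_nonneg fun k _ => hnn i k)] at h0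
    have h1 := h0 i (Finset.mem_univ _)
    rw [Finset.sum_eq_zero_iff_of_nonneg (fun k _ => hnn i k)] at h1
    have h2 := (mul_eq_zero.1 (h1 k (Finset.mem_univ _))).resolve_left hik
    rcases (hs k).eq_or_lt with h | h
    · have := (mul_eq_zero.1 (hker i k h.symm)).resolve_right hik
      rw [this, ← h]
    · exact (key _ _ (hp i) h).2 h2

/-- Entropy bound `S(AB) ≤ S(A) + log |B|` together with its equality case. -/
theorem klein_matrix {m a b : Type*} [Fintype m] [DecidableEq m] [Fintype a] [DecidableEq a]
    [Fintype b] [DecidableEq b] [Nonempty b] (e : m ≃ a × b)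
    (ρ : Matrix m m ℂ) (hρ : ρ.PosSemidef) (htr : ρ.trace = 1)
    (σ : Matrix a a ℂ) (hσp : σ.PosSemidef)
    (hσ : ∀ x y, σ x y = ∑ z, ρ (e.symm (x, z)) (e.symm (y, z))) :
    (vnEntropy ρ ≤ vnEntropy σ + Real.log (Fintype.card b)) ∧
    (vnEntropy ρ = vnEntropy σ + Real.log (Fintype.card b) →
      ∀ x y z w, ρ (e.symm (x, z)) (e.symm (y, w)) =
        if z = w then σ x y * (Fintype.card b : ℂ)⁻¹ else 0) := by
  classical
  have hH := hρ.isHermitian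
  have hσH := hσp.isHermitian
  set p := hH.eigenvalues with hpdef
  set α := hσH.eigenvalues with hαdef
  set U : Matrix m m ℂ := hH.eigenvectorUnitary.1 with hU
  set V : Matrix a a ℂ := hσH.eigenvectorUnitary.1 with hV
  have hUU : Uᴴ * U = 1 := Unitary.coe_star_mul_self hH.eigenvectorUnitary
  have hUU' : U * Uᴴ = 1 := Unitary.coe_mul_star_self hH.eigenvectorUnitary
  have hVV : Vᴴ * V = 1 := Unitary.coe_star_mul_self hσH.eigenvectorUnitary
  have hVV' : V * Vᴴ = 1 := Unitary.coe_mul_star_self hσH.eigenvectorUnitary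
  have hspec : ρ = U * Matrix.diagonal (fun i => (p i : ℂ)) * Uᴴ := by
    have := hH.spectral_theorem
    rw [Unitary.conjStarAlgAut_apply] at this
    exact this
  have hspecσ : σ = V * Matrix.diagonal (fun i => (α i : ℂ)) * Vᴴ := by
    have := hσH.spectral_theorem
    rw [Unitary.conjStarAlgAut_apply] at this
    exact this
  set U' : Matrix (a × b) m ℂ := U.submatrix e.symm id with hU'
  set ρ' : Matrix (a × b) (a × b) ℂ := ρ.submatrix e.symm e.symm with hρ'
  have hU1 : U'ᴴ * U' = 1 := by
    have : U'ᴴ * U' = (Uᴴ * U).submatrix id id := by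
      rw [hU', Matrix.conjTranspose_submatrix, Matrix.submatrix_mul_equiv]
    rw [this, hUU]; rfl
  have hU2 : U' * U'ᴴ = 1 := by
    have : U' * U'ᴴ = (U * Uᴴ).submatrix e.symm e.symm := by
      rw [hU', Matrix.conjTranspose_submatrix]
      exact Matrix.submatrix_mul_equiv _ _ _ (Equiv.refl m) _
    rw [this, hUU']; simp
  have hρ1 : ρ' = U' * Matrix.diagonal (fun i => (p i : ℂ)) * U'ᴴ := by
    rw [hρ', hspec]; rfl
  set W : Matrix (a × b) (a × b) ℂ := Matrix.kroneckerMap (· * ·) V (1 : Matrix b b ℂ) with hW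
  have hWH : Wᴴ = Matrix.kroneckerMap (· * ·) Vᴴ (1 : Matrix b b ℂ) := by
    rw [hW, Matrix.conjTranspose_kronecker, Matrix.conjTranspose_one]
  have hW1 : Wᴴ * W = 1 := by
    rw [hWH, hW, ← Matrix.mul_kronecker_mul, hVV, one_mul, Matrix.one_kronecker_one]
  have hW2 : W * Wᴴ = 1 := by
    rw [hWH, hW, ← Matrix.mul_kronecker_mul, hVV', one_mul, Matrix.one_kronecker_one]
  set C : Matrix m (a × b) ℂ := U'ᴴ * W with hC
  have hCH : Cᴴ = Wᴴ * U' := by rw [hC, Matrix.conjTranspose_mul, Matrix.conjTranspose_conjTranspose]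
  have hC1 : Cᴴ * C = 1 := by
    rw [hCH, hC, Matrix.mul_assoc, ← Matrix.mul_assoc U', hU2, Matrix.one_mul, hW1]
  have hC2 : C * Cᴴ = 1 := by
    rw [hCH, hC, Matrix.mul_assoc, ← Matrix.mul_assoc W, hW2, Matrix.one_mul, hU1]
  set B : ℝ := (Fintype.card b : ℝ) with hB
  have hBpos : 0 < B := by rw [hB]; exact_mod_cast Fintype.card_pos
  have hp0 : ∀ i, 0 ≤ p i := hρ.eigenvalues_nonneg
  have hα0 : ∀ i, 0 ≤ α i := hσp.eigenvalues_nonneg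
  -- diagonal of `Cᴴ D C`
  have hdiag : ∀ k, ∑ l, ∑ i, p i * Complex.normSq (C i (k, l)) = α k := by
    intro k
    have h1 : ∀ x, ((∑ i, p i * Complex.normSq (C i x) : ℝ) : ℂ)
        = (Cᴴ * Matrix.diagonal (fun i => (p i : ℂ)) * C) x x := by
      intro x
      rw [Matrix.mul_apply]
      push_cast
      refine Finset.sum_congr rfl fun i _ => ?_
      rw [Matrix.mul_diagonal, Matrix.conjTranspose_apply, Complex.normSq_eq_conj_mul_self]
      simp only [RCLike.star_def]
      ring
    have h2 : Cᴴ * Matrix.diagonal (fun i => (p i : ℂ)) * C = Wᴴ * ρ' * W := by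
      rw [hCH, hC, hρ1]; simp only [Matrix.mul_assoc]
    have h3 : Vᴴ * σ * V = Matrix.diagonal (fun i => (α i : ℂ)) := by
      rw [hspecσ, show Vᴴ * (V * Matrix.diagonal (fun i => (α i : ℂ)) * Vᴴ) * V
        = (Vᴴ * V) * Matrix.diagonal (fun i => (α i : ℂ)) * (Vᴴ * V) by
          simp only [Matrix.mul_assoc], hVV, Matrix.one_mul, Matrix.mul_one]
    have h4 : ∑ l, (Wᴴ * ρ' * W) (k, l) (k, l) = (Vᴴ * σ * V) k k := by
      have : ∀ l, (Wᴴ * ρ' * W) (k, l) (k, l) = ∑ y, ∑ x, Vᴴ k x * ρ' (x, l) (y, l) * V y k := by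
        intro l
        rw [hWH, hW]
        simp only [Matrix.mul_apply, Fintype.sum_prod_type, Matrix.kroneckerMap_apply,
          Matrix.one_apply]
        simp [Finset.sum_mul]
      simp only [this]
      rw [Finset.sum_comm]
      simp only [Matrix.mul_apply]
      refine Finset.sum_congr rfl fun y _ => ?_
      rw [Finset.sum_comm, Finset.sum_mul]
      refine Finset.sum_congr rfl fun x _ => ?_
      rw [hσ x y, Finset.mul_sum, Finset.sum_mul]
      rfl
    have h5 : ((∑ l, ∑ i, p i * Complex.normSq (C i (k, l)) : ℝ) : ℂ) = (α k : ℂ) := by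
      rw [Complex.ofReal_sum]
      simp only [h1, h2]
      rw [h4, h3, Matrix.diagonal_apply_eq]
    exact_mod_cast h5
  have hsp : ∑ i, p i = 1 := by
    have := hH.trace_eq_sum_eigenvalues
    rw [htr] at this
    have h' : ((∑ i, p i : ℝ) : ℂ) = 1 := by
      rw [Complex.ofReal_sum]; exact this.symm
    exact_mod_cast h'
  have hσtr : σ.trace = 1 := by
    rw [← htr]
    simp only [Matrix.trace, Matrix.diag_apply, hσ]
    rw [← Fintype.sum_prod_type' (f := fun x z => ρ (e.symm (x, z)) (e.symm (x, z)))]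
    exact Fintype.sum_equiv e.symm _ _ fun x => rfl
  have hsα : ∑ i, α i = 1 := by
    have := hσH.trace_eq_sum_eigenvalues
    rw [hσtr] at this
    have h' : ((∑ i, α i : ℝ) : ℂ) = 1 := by
      rw [Complex.ofReal_sum]; exact this.symm
    exact_mod_cast h'
  have hPnn : ∀ i k, 0 ≤ p i * Complex.normSq (C i k) :=
    fun i k => mul_nonneg (hp0 i) (Complex.normSq_nonneg _)
  have hk := klein_scalar p (fun x : a × b => α x.1 / B) (fun i x => Complex.normSq (C i x)) hp0
    (fun x => div_nonneg (hα0 _) hBpos.le) (fun i x => Complex.normSq_nonneg _)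
    (by
      intro i
      have := congrFun (congrFun hC2 i) i
      rw [Matrix.mul_apply, Matrix.one_apply_eq] at this
      have h' : ((∑ k, Complex.normSq (C i k) : ℝ) : ℂ) = 1 := by
        rw [← this, Complex.ofReal_sum]
        refine Finset.sum_congr rfl fun k _ => ?_
        rw [Complex.normSq_eq_conj_mul_self, Matrix.conjTranspose_apply, mul_comm]; rfl
      exact_mod_cast h')
    (by
      intro k
      have := congrFun (congrFun hC1 k) k
      rw [Matrix.mul_apply, Matrix.one_apply_eq] at this
      have h' : ((∑ i, Complex.normSq (C i k) : ℝ) : ℂ) = 1 := by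
        rw [← this, Complex.ofReal_sum]
        refine Finset.sum_congr rfl fun i _ => ?_
        rw [Complex.normSq_eq_conj_mul_self, Matrix.conjTranspose_apply]; rfl
      exact_mod_cast h')
    (by
      rw [hsp, Fintype.sum_prod_type]
      simp only [Finset.sum_const, Finset.card_univ, nsmul_eq_mul]
      rw [← hB]
      have : ∀ x, B * (α x / B) = α x := fun x => by field_simp
      simp only [this, hsα])
    (by
      rintro i ⟨k, l⟩ h0
      have h0' : α k = 0 := by
        rcases div_eq_zero_iff.1 h0 with h | h
        · exact h
        · exact absurd h hBpos.ne'
      have h := hdiag k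
      rw [h0', Finset.sum_eq_zero_iff_of_nonneg
        (fun l _ => Finset.sum_nonneg fun i _ => hPnn i _)] at h
      have h1 := h l (Finset.mem_univ _)
      rw [Finset.sum_eq_zero_iff_of_nonneg (fun i _ => hPnn i _)] at h1
      exact h1 i (Finset.mem_univ _))
  have hrhs : -∑ x : a × b, (∑ i, p i * Complex.normSq (C i x)) * Real.log (α x.1 / B)
      = vnEntropy σ + Real.log B := by
    rw [Fintype.sum_prod_type]
    simp only [← Finset.sum_mul, hdiag]
    have : ∀ k, α k * Real.log (α k / B) = α k * Real.log (α k) - α k * Real.log B := by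
      intro k
      rcases (hα0 k).eq_or_lt with h | h
      · rw [← h]; simp
      · rw [Real.log_div h.ne' hBpos.ne']; ring
    simp only [this, Finset.sum_sub_distrib, ← Finset.sum_mul, hsα]
    rw [vnEntropy, dif_pos hσH]
    ring
  have hlhs : -∑ i, p i * Real.log (p i) = vnEntropy ρ := by
    rw [vnEntropy, dif_pos hH]
  rw [hrhs, hlhs] at hk
  refine ⟨hk.1, fun heq x y z w => ?_⟩
  have hpc := hk.2 heq
  have hDC : Matrix.diagonal (fun i => (p i : ℂ)) * C
      = C * Matrix.diagonal (fun x : a × b => ((α x.1 / B : ℝ) : ℂ)) := by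
    ext i x
    rw [Matrix.diagonal_mul, Matrix.mul_diagonal]
    by_cases h : C i x = 0
    · rw [h]; simp
    · rw [hpc i x (by simpa using h), mul_comm]
  have hfin : ρ' = W * Matrix.diagonal (fun x : a × b => ((α x.1 / B : ℝ) : ℂ)) * Wᴴ := by
    have hWC : W = U' * C := by rw [hC, ← Matrix.mul_assoc, hU2, Matrix.one_mul]
    have hUC : U'ᴴ = C * Wᴴ := by rw [hC, Matrix.mul_assoc, hW2, Matrix.mul_one]
    calc ρ' = U' * (Matrix.diagonal (fun i => (p i : ℂ)) * C) * Wᴴ := by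
          rw [hρ1, hUC]; simp only [Matrix.mul_assoc]
      _ = _ := by rw [hDC, ← Matrix.mul_assoc, ← hWC]
  have : ρ (e.symm (x, z)) (e.symm (y, w)) = ρ' (x, z) (y, w) := rfl
  rw [this, hfin, hWH, hW, hspecσ]
  rw [Matrix.mul_apply, Matrix.mul_apply]
  simp only [Matrix.mul_diagonal, Fintype.sum_prod_type,
    Matrix.kroneckerMap_apply, Matrix.one_apply]
  by_cases hzw : z = w
  · subst hzw
    simp [Finset.sum_mul, hB]
    refine Finset.sum_congr rfl fun k _ => ?_
    ring
  · simp [hzw]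

/-- Entropy of the maximally mixed state. -/
theorem vnEntropy_maxmixed {m : Type*} [Fintype m] [DecidableEq m] [Nonempty m] :
    vnEntropy (((Fintype.card m : ℕ) : ℂ)⁻¹ • (1 : Matrix m m ℂ)) = Real.log (Fintype.card m) := by
  have hH : (((Fintype.card m : ℕ) : ℂ)⁻¹ • (1 : Matrix m m ℂ)).IsHermitian := by
    ext i j
    by_cases h : i = j
    · subst h; simp
    · simp [Matrix.one_apply, h, Ne.symm h]
  have hev : ∀ j, hH.eigenvalues j = ((Fintype.card m : ℕ) : ℝ)⁻¹ := by
    intro j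
    have h := hH.mulVec_eigenvectorBasis j
    rw [Matrix.smul_mulVec, Matrix.one_mulVec] at h
    have hne : (hH.eigenvectorBasis j) ≠ 0 := hH.eigenvectorBasis.orthonormal.ne_zero j
    have : ∃ i, (hH.eigenvectorBasis j) i ≠ 0 := by
      by_contra hcon
      push Not at hcon
      exact hne (by ext i; exact hcon i)
    obtain ⟨i, hi⟩ := this
    have h2 := congrFun h i
    simp only [Pi.smul_apply, smul_eq_mul, Complex.real_smul] at h2
    have h3 := mul_right_cancel₀ hi h2
    have h4 : (((((Fintype.card m : ℕ) : ℝ)⁻¹ : ℝ)) : ℂ) = (hH.eigenvalues j : ℂ) := by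
      push_cast; exact h3
    exact_mod_cast h4.symm
  rw [vnEntropy, dif_pos hH]
  simp only [hev]
  have : ((Fintype.card m : ℕ) : ℝ) ≠ 0 := by exact_mod_cast Fintype.card_ne_zero
  simp [Real.log_inv, this]

end

theorem marginal_posSemidef_s6 {ι : Type*} [Fintype ι] [DecidableEq ι] {dim : ι → ℕ}
    (ρ : Matrix ((i : ι) → Fin (dim i)) ((i : ι) → Fin (dim i)) ℂ) (hρ : ρ.PosSemidef)
    (S : Finset ι) : (marginal ρ S).PosSemidef := by
  have : marginal ρ S = ∑ z : (i : {j : ι // j ∉ S}) → Fin (dim i.1),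
      ρ.submatrix (fun x i => if h : i ∈ S then x ⟨i, h⟩ else z ⟨i, h⟩)
        (fun x i => if h : i ∈ S then x ⟨i, h⟩ else z ⟨i, h⟩) := by
    ext x y
    rw [Matrix.sum_apply]
    rfl
  rw [this]
  exact Matrix.posSemidef_sum _ fun z _ => hρ.submatrix _

theorem marginal_trace_s6 {ι : Type*} [Fintype ι] [DecidableEq ι] {dim : ι → ℕ}
    (ρ : Matrix ((i : ι) → Fin (dim i)) ((i : ι) → Fin (dim i)) ℂ)
    (S : Finset ι) : (marginal ρ S).trace = ρ.trace := by
  simp only [Matrix.trace, Matrix.diag_apply, marginal]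
  rw [← Fintype.sum_prod_type' (f := fun (x : (i : {j : ι // j ∈ S}) → Fin (dim i.1))
    (z : (i : {j : ι // j ∉ S}) → Fin (dim i.1)) =>
      ρ (fun i => if h : i ∈ S then x ⟨i, h⟩ else z ⟨i, h⟩)
        (fun i => if h : i ∈ S then x ⟨i, h⟩ else z ⟨i, h⟩))]
  exact Fintype.sum_equiv (Equiv.piEquivPiSubtypeProd (fun i => i ∈ S) (fun i => Fin (dim i))).symm
    _ _ fun x => rfl

/-- Configurations on `A ∪ B` are pairs of configurations on `A` and on `B`. -/
def splitEquiv {ι : Type*} [DecidableEq ι] (β : ι → Type*) (A B S : Finset ι)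
    (hAB : Disjoint A B) (hS : ∀ i, i ∈ S ↔ i ∈ A ∨ i ∈ B) :
    ((i : {j : ι // j ∈ S}) → β i.1) ≃
      ((i : {j : ι // j ∈ A}) → β i.1) × ((i : {j : ι // j ∈ B}) → β i.1) where
  toFun f := (fun i => f ⟨i.1, (hS _).2 (Or.inl i.2)⟩, fun i => f ⟨i.1, (hS _).2 (Or.inr i.2)⟩)
  invFun f i := if h : i.1 ∈ A then f.1 ⟨i.1, h⟩
    else f.2 ⟨i.1, ((hS _).1 i.2).resolve_left h⟩
  left_inv f := by
    funext i
    by_cases h : i.1 ∈ A <;> simp [h]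
  right_inv f := by
    obtain ⟨f, g⟩ := f
    refine Prod.ext ?_ ?_
    · funext i
      simp [i.2]
    · funext i
      have h : i.1 ∉ A := fun h => (Finset.disjoint_left.1 hAB h) i.2
      simp [h]

/-- Configurations off `A` are pairs of configurations on `B` and off `A ∪ B`. -/
def splitEquivCompl {ι : Type*} [DecidableEq ι] (β : ι → Type*) (A B S : Finset ι)
    (hAB : Disjoint A B) (hS : ∀ i, i ∈ S ↔ i ∈ A ∨ i ∈ B) :
    ((i : {j : ι // j ∉ A}) → β i.1) ≃
      ((i : {j : ι // j ∈ B}) → β i.1) × ((i : {j : ι // j ∉ S}) → β i.1) where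
  toFun f := (fun i => f ⟨i.1, fun h => (Finset.disjoint_left.1 hAB h) i.2⟩,
    fun i => f ⟨i.1, fun h => i.2 ((hS _).2 (Or.inl h))⟩)
  invFun f i := if h : i.1 ∈ B then f.1 ⟨i.1, h⟩
    else f.2 ⟨i.1, fun h' => ((hS _).1 h').elim i.2 h⟩
  left_inv f := by
    funext i
    by_cases h : i.1 ∈ B <;> simp [h]
  right_inv f := by
    obtain ⟨f, g⟩ := f
    refine Prod.ext ?_ ?_
    · funext i
      simp [i.2]
    · funext i
      have h : i.1 ∉ B := fun h => i.2 ((hS _).2 (Or.inr h))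
      simp [h]

theorem marginal_tower {ι : Type*} [Fintype ι] [DecidableEq ι] {dim : ι → ℕ}
    (ρ : Matrix ((i : ι) → Fin (dim i)) ((i : ι) → Fin (dim i)) ℂ)
    (A B S : Finset ι) (hAB : Disjoint A B) (hS : ∀ i, i ∈ S ↔ i ∈ A ∨ i ∈ B)
    (x y : (i : {j : ι // j ∈ A}) → Fin (dim i.1)) :
    marginal ρ A x y = ∑ w, marginal ρ S
      ((splitEquiv (fun i => Fin (dim i)) A B S hAB hS).symm (x, w))
      ((splitEquiv (fun i => Fin (dim i)) A B S hAB hS).symm (y, w)) := by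
  simp only [marginal]
  rw [← Fintype.sum_prod_type' (f := fun (w : (i : {j : ι // j ∈ B}) → Fin (dim i.1))
    (z : (i : {j : ι // j ∉ S}) → Fin (dim i.1)) =>
    ρ (fun i => if h : i ∈ S then
        (splitEquiv (fun i => Fin (dim i)) A B S hAB hS).symm (x, w) ⟨i, h⟩ else z ⟨i, h⟩)
      (fun i => if h : i ∈ S then
        (splitEquiv (fun i => Fin (dim i)) A B S hAB hS).symm (y, w) ⟨i, h⟩ else z ⟨i, h⟩))]
  have aux : ∀ (x : (i : {j : ι // j ∈ A}) → Fin (dim i.1))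
      (z : (i : {j : ι // j ∉ A}) → Fin (dim i.1)),
      (fun i => if h : i ∈ A then x ⟨i, h⟩ else z ⟨i, h⟩ : (i : ι) → Fin (dim i)) =
      fun i => if h : i ∈ S then
        (splitEquiv (fun i => Fin (dim i)) A B S hAB hS).symm
          (x, (splitEquivCompl (fun i => Fin (dim i)) A B S hAB hS z).1) ⟨i, h⟩
        else (splitEquivCompl (fun i => Fin (dim i)) A B S hAB hS z).2 ⟨i, h⟩ := by
    intro x z
    funext i
    by_cases hA : i ∈ A
    · have h : i ∈ S := (hS i).2 (Or.inl hA)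
      simp [splitEquiv, hA, h]
    · by_cases hB : i ∈ B
      · have h : i ∈ S := (hS i).2 (Or.inr hB)
        simp [splitEquiv, splitEquivCompl, hA, h]
      · have h : i ∉ S := fun h => ((hS i).1 h).elim hA hB
        simp [splitEquivCompl, hA, h]
  refine Fintype.sum_equiv (splitEquivCompl (fun i => Fin (dim i)) A B S hAB hS) _ _ fun z => ?_
  rw [aux x z, aux y z]

/-- The marginal on `S` is maximally mixed at the site `i` (and uncorrelated with the rest). -/
def SiteMixed {ι : Type*} [Fintype ι] [DecidableEq ι] {dim : ι → ℕ}
    (ρ : Matrix ((i : ι) → Fin (dim i)) ((i : ι) → Fin (dim i)) ℂ)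
    (S : Finset ι) (i : {j : ι // j ∈ S}) : Prop :=
  (∀ x y, x i ≠ y i → marginal ρ S x y = 0) ∧
  (∀ x y c, x i = y i →
    marginal ρ S (Function.update x i c) (Function.update y i c) = marginal ρ S x y)

theorem SiteMixed.mono {ι : Type*} [Fintype ι] [DecidableEq ι] {dim : ι → ℕ}
    {ρ : Matrix ((i : ι) → Fin (dim i)) ((i : ι) → Fin (dim i)) ℂ}
    {A S : Finset ι} (hAS : A ⊆ S) (i : ι) (hi : i ∈ A) (h : SiteMixed ρ S ⟨i, hAS hi⟩) :
    SiteMixed ρ A ⟨i, hi⟩ := by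
  have hS : ∀ i, i ∈ S ↔ i ∈ A ∨ i ∈ S \ A := by
    intro i
    by_cases h : i ∈ A
    · simp [h, hAS h]
    · simp [h]
  have hAB : Disjoint A (S \ A) := Finset.disjoint_sdiff
  have hval : ∀ x w, (splitEquiv (fun i => Fin (dim i)) A (S \ A) S hAB hS).symm (x, w)
      ⟨i, hAS hi⟩ = x ⟨i, hi⟩ := by
    intro x w; simp [splitEquiv, hi]
  have hupd : ∀ x w c, (splitEquiv (fun i => Fin (dim i)) A (S \ A) S hAB hS).symm
      (Function.update x ⟨i, hi⟩ c, w) = Function.update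
        ((splitEquiv (fun i => Fin (dim i)) A (S \ A) S hAB hS).symm (x, w)) ⟨i, hAS hi⟩ c := by
    intro x w c
    funext k
    obtain ⟨k, hk⟩ := k
    by_cases hki : k = i
    · subst hki; simp [splitEquiv, hi]
    · have h1 : (⟨k, hk⟩ : {j : ι // j ∈ S}) ≠ ⟨i, hAS hi⟩ := fun h => hki (congrArg Subtype.val h)
      rw [Function.update_of_ne h1]
      by_cases hkA : k ∈ A
      · have h2 : (⟨k, hkA⟩ : {j : ι // j ∈ A}) ≠ ⟨i, hi⟩ := fun h => hki (congrArg Subtype.val h)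
        simp [splitEquiv, hkA, Function.update_of_ne h2]
      · simp [splitEquiv, hkA]
  refine ⟨fun x y hxy => ?_, fun x y c hxy => ?_⟩
  · rw [marginal_tower ρ A (S \ A) S hAB hS]
    refine Finset.sum_eq_zero fun w _ => h.1 _ _ ?_
    rwa [hval, hval]
  · rw [marginal_tower ρ A (S \ A) S hAB hS, marginal_tower ρ A (S \ A) S hAB hS]
    refine Finset.sum_congr rfl fun w _ => ?_
    rw [hupd, hupd]
    refine h.2 _ _ _ ?_
    rw [hval, hval, hxy]

theorem const_of_update {ι : Type*} [Fintype ι] [DecidableEq ι] {β : ι → Type*}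
    (f : (∀ i, β i) → ℂ) (h : ∀ x i c, f (Function.update x i c) = f x) (x y : ∀ i, β i) :
    f x = f y := by
  have : ∀ s : Finset ι, f (s.piecewise x y) = f y := by
    intro s
    induction s using Finset.induction_on with
    | empty => simp
    | insert a s ha ih => rw [Finset.piecewise_insert, h, ih]
  have h2 := this Finset.univ
  rwa [Finset.piecewise_univ] at h2

theorem maxmixed_of_siteMixed {ι : Type*} [Fintype ι] [DecidableEq ι] {dim : ι → ℕ}
    (ρ : Matrix ((i : ι) → Fin (dim i)) ((i : ι) → Fin (dim i)) ℂ) (htr : ρ.trace = 1)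
    (S : Finset ι) (h : ∀ i, SiteMixed ρ S i) :
    marginal ρ S =
      ((Fintype.card ((i : {j : ι // j ∈ S}) → Fin (dim i.1)) : ℕ) : ℂ)⁻¹ • 1 := by
  have hconst := const_of_update (fun x => marginal ρ S x x)
    (fun x i c => (h i).2 x x c rfl)
  have ht := marginal_trace_s6 ρ S
  rw [htr] at ht
  ext x y
  by_cases hxy : x = y
  · subst hxy
    have h1 : (marginal ρ S).trace =
        (Fintype.card ((i : {j : ι // j ∈ S}) → Fin (dim i.1)) : ℕ) * marginal ρ S x x := by
      simp only [Matrix.trace, Matrix.diag_apply]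
      rw [Finset.sum_congr rfl fun y _ => hconst y x]
      simp
    rw [ht] at h1
    simp only [Matrix.smul_apply, Matrix.one_apply_eq, smul_eq_mul, mul_one]
    exact eq_inv_of_mul_eq_one_right h1.symm
  · obtain ⟨i, hi⟩ := Function.ne_iff.1 hxy
    rw [(h i).1 x y hi]
    simp [Matrix.one_apply_ne hxy]

theorem card_config_aux {ι : Type*} [Fintype ι] [DecidableEq ι] (dim : ι → ℕ) (S : Finset ι)
    {inst : Fintype ((i : {j : ι // j ∈ S}) → Fin (dim i.1))} :
    @Fintype.card ((i : {j : ι // j ∈ S}) → Fin (dim i.1)) inst = ∏ i ∈ S, dim i := by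
  have h1 : @Fintype.card ((i : {j : ι // j ∈ S}) → Fin (dim i.1)) inst
      = @Fintype.card ((i : {j : ι // j ∈ S}) → Fin (dim i.1))
        (@Pi.instFintype _ _ _ (Finset.Subtype.fintype S) _) :=
    congrArg (@Fintype.card _) (Subsingleton.elim _ _)
  rw [h1, Fintype.card_pi]
  simp only [Fintype.card_fin]
  exact Finset.prod_coe_sort S dim

theorem card_config {n q : ℕ} (dim : Fin n ⊕ Unit → ℕ) (hdimX : ∀ i : Fin n, dim (Sum.inl i) = q)
    (J : Finset (Fin n))
    {inst : Fintype ((i : {j : Fin n ⊕ Unit // j ∈ J.image Sum.inl}) → Fin (dim i.1))} :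
    @Fintype.card ((i : {j : Fin n ⊕ Unit // j ∈ J.image Sum.inl}) → Fin (dim i.1)) inst
      = q ^ J.card := by
  rw [card_config_aux dim, Finset.prod_image (fun _ _ _ _ h => Sum.inl_injective h)]
  simp [hdimX]

/-- every QMDS code is pure: all `(d-1)`-body marginals are
maximally mixed. `R = Sum.inr ()`. -/
theorem qmds_is_pure
    (n d K q : ℕ) (hq : 2 ≤ q) (hK : 2 ≤ K) (hd : 2 ≤ d) (hdn : 2 * (d - 1) < n)
    (dim : Fin n ⊕ Unit → ℕ)
    (hdimX : ∀ i : Fin n, dim (Sum.inl i) = q)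
    (hdimR : dim (Sum.inr ()) = K)
    (ψ : Matrix ((i : Fin n ⊕ Unit) → Fin (dim i))
                ((i : Fin n ⊕ Unit) → Fin (dim i)) ℂ)
    (hpsd : ψ.PosSemidef) (htr : ψ.trace = 1) (hpure : ψ.rank = 1)
    (hmaxmix : marginal ψ ({Sum.inr ()} : Finset (Fin n ⊕ Unit)) = (K : ℂ)⁻¹ • 1)
    (hdec : ∀ I J : Finset (Fin n), Disjoint I J → I ∪ J = Finset.univ →
      I.card = n - d + 1 → J.card = d - 1 →
      mEnt ψ (I.image Sum.inl) =
        mEnt ψ ({Sum.inr ()} : Finset (Fin n ⊕ Unit)) + mEnt ψ (J.image Sum.inl))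
    (hMDS : Real.log K = ((n : ℝ) - 2 * d + 2) * Real.log q) :
    ∀ J : Finset (Fin n), J.card = d - 1 →
      marginal ψ (J.image Sum.inl) = ((q : ℂ) ^ (d - 1))⁻¹ • 1 := by
  classical
  obtain ⟨m, hm⟩ : ∃ m, n = 2 * (d - 1) + m := ⟨n - 2 * (d - 1), by omega⟩
  have hm0 : 1 ≤ m := by omega
  have hKq : Real.log K = Real.log ((q ^ m : ℕ) : ℝ) := by
    rw [hMDS]
    push_cast
    rw [Real.log_pow]
    congr 1
    obtain ⟨d', rfl⟩ : ∃ d', d = d' + 1 := ⟨d - 1, by omega⟩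
    have h : ((n : ℕ) : ℝ) = 2 * d' + m := by rw [hm]; push_cast; simp
    rw [h]; push_cast; ring
  -- entropy of the reference
  have hSR : mEnt ψ ({Sum.inr ()} : Finset (Fin n ⊕ Unit)) = Real.log K := by
    have hc : Fintype.card ((i : {j : Fin n ⊕ Unit // j ∈ ({Sum.inr ()} : Finset (Fin n ⊕ Unit))})
        → Fin (dim i.1)) = K := by
      rw [Fintype.card_pi]
      simp only [Fintype.card_fin]
      rw [Finset.prod_coe_sort ({Sum.inr ()} : Finset (Fin n ⊕ Unit)) dim]
      simp [hdimR]
    have : Nonempty ((i : {j : Fin n ⊕ Unit // j ∈ ({Sum.inr ()} : Finset (Fin n ⊕ Unit))})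
        → Fin (dim i.1)) := Fintype.card_pos_iff.1 (by omega)
    have h := vnEntropy_maxmixed (m := ((i : {j : Fin n ⊕ Unit //
      j ∈ ({Sum.inr ()} : Finset (Fin n ⊕ Unit))}) → Fin (dim i.1)))
    rw [hc] at h
    rw [mEnt, hmaxmix, h]
  have hdisjim : ∀ A B : Finset (Fin n), Disjoint A B →
      Disjoint (A.image (Sum.inl : Fin n → Fin n ⊕ Unit)) (B.image Sum.inl) :=
    fun A B h => (Finset.disjoint_image Sum.inl_injective).2 h
  have hmemim : ∀ A B : Finset (Fin n), ∀ i : Fin n ⊕ Unit,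
      i ∈ (A ∪ B).image Sum.inl ↔ i ∈ A.image Sum.inl ∨ i ∈ B.image Sum.inl := by
    intro A B i
    rw [Finset.image_union, Finset.mem_union]
  -- Klein's inequality for disjoint sets
  have hklein : ∀ (A M : Finset (Fin n)) (hAM : Disjoint A M), M.card = m →
      (mEnt ψ ((A ∪ M).image Sum.inl) ≤ mEnt ψ (A.image Sum.inl) + Real.log K) ∧
      (mEnt ψ ((A ∪ M).image Sum.inl) = mEnt ψ (A.image Sum.inl) + Real.log K →
        ∀ x y z w, marginal ψ ((A ∪ M).image Sum.inl)
          ((splitEquiv (fun i => Fin (dim i)) _ _ _ (hdisjim A M hAM) (hmemim A M)).symm (x, z))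
          ((splitEquiv (fun i => Fin (dim i)) _ _ _ (hdisjim A M hAM) (hmemim A M)).symm (y, w))
          = if z = w then marginal ψ (A.image Sum.inl) x y * ((q ^ m : ℕ) : ℂ)⁻¹ else 0) := by
    intro A M hAM hMc
    have hc : ∀ inst, @Fintype.card ((i : {j : Fin n ⊕ Unit // j ∈ M.image Sum.inl})
        → Fin (dim i.1)) inst = q ^ m := fun inst => by rw [card_config dim hdimX M, hMc]
    have : Nonempty ((i : {j : Fin n ⊕ Unit // j ∈ M.image Sum.inl}) → Fin (dim i.1)) :=
      Fintype.card_pos_iff.1 (by rw [hc]; positivity)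
    have h := klein_matrix
      (splitEquiv (fun i => Fin (dim i)) _ _ _ (hdisjim A M hAM) (hmemim A M))
      (marginal ψ ((A ∪ M).image Sum.inl)) (marginal_posSemidef_s6 ψ hpsd _)
      (by rw [marginal_trace_s6, htr]) (marginal ψ (A.image Sum.inl)) (marginal_posSemidef_s6 ψ hpsd _)
      (fun x y => marginal_tower ψ _ _ _ (hdisjim A M hAM) (hmemim A M) x y)
    rw [hc, ← hKq] at h
    exact h
  intro J hJ
  have hsite : ∀ i, SiteMixed ψ (J.image Sum.inl) i := by
    rintro ⟨i', hi'⟩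
    obtain ⟨i, hi, rfl⟩ := Finset.mem_image.1 hi'
    have hJe : (J.erase i).card = d - 2 := by rw [Finset.card_erase_of_mem hi, hJ]; omega
    obtain ⟨M, hM1, hM2, hMc⟩ := Finset.exists_subsuperset_card_eq
      (s := {i}) (t := Finset.univ \ J.erase i) (n := m)
      (by simp) (by simpa using hm0)
      (by rw [Finset.card_sdiff_of_subset (Finset.subset_univ _), hJe, Finset.card_univ,
            Fintype.card_fin]; omega)
    have hiM : i ∈ M := by simpa using hM1
    have hdJM : Disjoint (J.erase i) M :=
      Finset.disjoint_of_subset_right hM2 Finset.disjoint_sdiff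
    obtain ⟨A, hA1, hA2, hAc⟩ := Finset.exists_subsuperset_card_eq
      (s := J.erase i) (t := Finset.univ \ M) (n := d - 1)
      (Finset.subset_sdiff.2 ⟨Finset.subset_univ _, hdJM⟩) (by omega)
      (by rw [Finset.card_sdiff_of_subset (Finset.subset_univ _), hMc, Finset.card_univ,
            Fintype.card_fin]; omega)
    have hAM : Disjoint A M := (Finset.subset_sdiff.1 hA2).2
    have hAMc : (A ∪ M).card = (d - 1) + m := by
      rw [Finset.card_union_of_disjoint hAM, hAc, hMc]
    obtain ⟨L, hL⟩ : ∃ L : Finset (Fin n), L = Finset.univ \ (A ∪ M) := ⟨_, rfl⟩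
    have hLc : L.card = d - 1 := by
      rw [hL, Finset.card_sdiff_of_subset (Finset.subset_univ _), hAMc, Finset.card_univ,
            Fintype.card_fin]; omega
    have hLd : Disjoint (A ∪ M) L := by rw [hL]; exact Finset.disjoint_sdiff
    have hLu : (A ∪ M) ∪ L = Finset.univ := by
      rw [hL]; exact Finset.union_sdiff_of_subset (Finset.subset_univ _)
    have hLA : Disjoint A L := Finset.disjoint_of_subset_left Finset.subset_union_left hLd
    have hLM : Disjoint M L := Finset.disjoint_of_subset_left Finset.subset_union_right hLd
    have h1 := hdec (A ∪ M) L hLd hLu (by omega) hLc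
    have h2 := hdec (L ∪ M) A (Finset.disjoint_union_left.2 ⟨hLA.symm, hAM.symm⟩)
      (by rw [← hLu, Finset.union_comm (L ∪ M), Finset.union_comm L M, Finset.union_assoc])
      (by rw [Finset.card_union_of_disjoint hLM.symm, hLc, hMc]; omega) hAc
    have h3 := hklein A M hAM hMc
    have h4 := (hklein L M hLM.symm hMc).1
    rw [hSR] at h1 h2
    have h5 := h3.2 (by linarith [h3.1])
    have hsub : J.image (Sum.inl : Fin n → Fin n ⊕ Unit) ⊆ (A ∪ M).image Sum.inl := by
      apply Finset.image_subset_image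
      intro k hk
      by_cases hki : k = i
      · subst hki; exact Finset.mem_union_right _ hiM
      · exact Finset.mem_union_left _ (hA1 (Finset.mem_erase.2 ⟨hki, hk⟩))
    refine SiteMixed.mono hsub (Sum.inl i) hi' ?_
    have hiA : (Sum.inl i : Fin n ⊕ Unit) ∉ A.image Sum.inl := by
      intro h
      obtain ⟨k, hk, hki⟩ := Finset.mem_image.1 h
      rw [Sum.inl_injective hki] at hk
      exact Finset.disjoint_left.1 hAM hk hiM
    have hiM' : (Sum.inl i : Fin n ⊕ Unit) ∈ M.image Sum.inl := Finset.mem_image_of_mem _ hiM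
    set e := splitEquiv (fun i => Fin (dim i)) _ _ _ (hdisjim A M hAM) (hmemim A M) with he
    have h6 : ∀ x y, marginal ψ ((A ∪ M).image Sum.inl) x y = if (e x).2 = (e y).2 then
        marginal ψ (A.image Sum.inl) (e x).1 (e y).1 * ((q ^ m : ℕ) : ℂ)⁻¹ else 0 := by
      intro x y
      rw [← h5, Prod.mk.eta, Prod.mk.eta, Equiv.symm_apply_apply, Equiv.symm_apply_apply]
    have hu1 : ∀ x c, (e (Function.update x ⟨Sum.inl i, hsub hi'⟩ c)).1 = (e x).1 := by
      intro x c
      funext k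
      have : k.1 ≠ Sum.inl i := fun h => hiA (h ▸ k.2)
      simp only [he, splitEquiv, Equiv.coe_fn_mk]
      rw [Function.update_of_ne]
      intro h; exact this (congrArg Subtype.val h)
    have hu2 : ∀ x c, (e (Function.update x ⟨Sum.inl i, hsub hi'⟩ c)).2
        = Function.update (e x).2 ⟨Sum.inl i, hiM'⟩ c := by
      intro x c
      funext k
      obtain ⟨k, hk⟩ := k
      by_cases hki : k = Sum.inl i
      · subst hki; simp [he, splitEquiv]
      · rw [Function.update_of_ne (fun h => hki (congrArg Subtype.val h))]
        simp only [he, splitEquiv, Equiv.coe_fn_mk]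
        rw [Function.update_of_ne (fun h => hki (congrArg Subtype.val h))]
    have hv : ∀ x, (e x).2 ⟨Sum.inl i, hiM'⟩ = x ⟨Sum.inl i, hsub hi'⟩ := fun x => rfl
    refine ⟨fun x y hxy => ?_, fun x y c hxy => ?_⟩
    · rw [h6, if_neg]
      intro h
      exact hxy (by rw [← hv x, ← hv y, h])
    · rw [h6, h6 x y, hu1, hu1, hu2, hu2]
      have : Function.update (e x).2 ⟨Sum.inl i, hiM'⟩ c = Function.update (e y).2 ⟨Sum.inl i, hiM'⟩ c
          ↔ (e x).2 = (e y).2 := by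
        constructor
        · intro h
          funext k
          by_cases hk : k = ⟨Sum.inl i, hiM'⟩
          · rw [hk, hv, hv, hxy]
          · have := congrFun h k
            rwa [Function.update_of_ne hk, Function.update_of_ne hk] at this
        · intro h; rw [h]
      simp only [this]
  rw [maxmixed_of_siteMixed ψ htr _ hsite, card_config dim hdimX J, hJ]
  push_cast
  rfl
end
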